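/- arXiv:1701.03955 — 3 statements merged into one kernel-verified Lean document; each statement's English description precedes it below -/
import Mathlib

section
/- For every integer N ≥ 1 and every p ∈ [1,∞), the nested distance d_p^nd is a metric on 𝒫^p(ℝ^N): for all μ, ν, η ∈ 𝒫^p(ℝ^N) it is finite, nonnegative and symmetric, d_p^nd(μ,ν) = 0 if and only if μ = ν, and d_p^nd(μ,ν) ≤ d_p^nd(μ,η) + d_p^nd(η,ν). -/
open MeasureTheory ProbabilityTheory Filter
open scoped ENNReal NNReal Topology

noncomputable section

/-- `dund` is a metric on `ℝ` inducing the usual topology. -/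
structure IsCompatibleMetric (dund : ℝ → ℝ → ℝ) : Prop where
  self_eq_zero : ∀ x, dund x x = 0
  eq_of_dist_eq_zero : ∀ x y, dund x y = 0 → x = y
  symm : ∀ x y, dund x y = dund y x
  triangle : ∀ x y z, dund x z ≤ dund x y + dund y z
  compatible : ∀ (x : ℝ) (u : ℕ → ℝ),
    Tendsto u atTop (nhds x) ↔ Tendsto (fun n => dund (u n) x) atTop (nhds 0)

/-- Couplings: measures on the product with prescribed marginals. -/
def coupling {α β : Type*} [MeasurableSpace α] [MeasurableSpace β]
    (μ : Measure α) (ν : Measure β) : Set (Measure (α × β)) :=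
  {γ | γ.map Prod.fst = μ ∧ γ.map Prod.snd = ν}

/-- Projection onto the first `t` coordinates. -/
def proj (N t : ℕ) (ht : t ≤ N) (x : Fin N → ℝ) : Fin t → ℝ :=
  fun i => x (Fin.castLE ht i)

/-- The σ-algebra generated by the first `t` coordinates of the first (`x`) component. -/
def sigmaX (N t : ℕ) (ht : t ≤ N) : MeasurableSpace ((Fin N → ℝ) × (Fin N → ℝ)) :=
  MeasurableSpace.comap (fun z => proj N t ht z.1) inferInstance

/-- The σ-algebra generated by the first `t` coordinates of the second (`y`) component. -/
def sigmaY (N t : ℕ) (ht : t ≤ N) : MeasurableSpace ((Fin N → ℝ) × (Fin N → ℝ)) :=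
  MeasurableSpace.comap (fun z => proj N t ht z.2) inferInstance

/-- The σ-algebra generated by all coordinates of the first (`x`) component. -/
def sigmaXfull (N : ℕ) : MeasurableSpace ((Fin N → ℝ) × (Fin N → ℝ)) :=
  MeasurableSpace.comap Prod.fst inferInstance

/-- The σ-algebra generated by all coordinates of the second (`y`) component. -/
def sigmaYfull (N : ℕ) : MeasurableSpace ((Fin N → ℝ) × (Fin N → ℝ)) :=
  MeasurableSpace.comap Prod.snd inferInstance

/-- A coupling `γ`, viewed as the joint law of processes `X, Y`, is bicausal if for every
`t < N` and Borel `B ⊆ ℝ^t`, `ℙ((Y₁,…,Y_t) ∈ B | X₁,…,X_N) = ℙ((Y₁,…,Y_t) ∈ B | X₁,…,X_t)`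
a.s. and symmetrically in `X` and `Y`. -/
def Bicausal (N : ℕ) (γ : Measure ((Fin N → ℝ) × (Fin N → ℝ))) : Prop :=
  ∀ (t : ℕ) (ht : t < N) (B : Set (Fin t → ℝ)), MeasurableSet B →
    (γ[fun z => Set.indicator B (fun _ => (1 : ℝ)) (proj N t ht.le z.2) | sigmaXfull N]
      =ᵐ[γ]
     γ[fun z => Set.indicator B (fun _ => (1 : ℝ)) (proj N t ht.le z.2) | sigmaX N t ht.le]) ∧
    (γ[fun z => Set.indicator B (fun _ => (1 : ℝ)) (proj N t ht.le z.1) | sigmaYfull N]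
      =ᵐ[γ]
     γ[fun z => Set.indicator B (fun _ => (1 : ℝ)) (proj N t ht.le z.1) | sigmaY N t ht.le])

/-- The `p`-th power cost `d(x,y)^p = ∑_t d̲(x_t,y_t)^p`. -/
def costp (N : ℕ) (p : ℝ) (dund : ℝ → ℝ → ℝ) (z : (Fin N → ℝ) × (Fin N → ℝ)) : ℝ :=
  ∑ t : Fin N, dund (z.1 t) (z.2 t) ^ p

/-- The nested distance `d_p^nd(μ,ν) = (inf_{γ ∈ Π_bc(μ,ν)} ∫ d^p dγ)^{1/p}`. -/
def nestedDist (N : ℕ) (p : ℝ) (dund : ℝ → ℝ → ℝ)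
    (μ ν : Measure (Fin N → ℝ)) : ℝ≥0∞ :=
  (⨅ γ : {γ : Measure ((Fin N → ℝ) × (Fin N → ℝ)) // γ ∈ coupling μ ν ∧ Bicausal N γ},
      ∫⁻ z, ENNReal.ofReal (costp N p dund z) ∂(γ : Measure _)) ^ (1 / p)

/-- Membership in `𝒫^p(ℝ^N)`: a probability measure with a finite `p`-th moment. -/
def MemPp (N : ℕ) (p : ℝ) (dund : ℝ → ℝ → ℝ) (μ : Measure (Fin N → ℝ)) : Prop :=
  IsProbabilityMeasure μ ∧
    ∃ x₀ : Fin N → ℝ, ∫⁻ x, ENNReal.ofReal (costp N p dund (x, x₀)) ∂μ < ⊤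

/-- The random variable `Y` is causal with respect to `X` along `f`: given `X`, the conditional law
of `Y` under `γ` is a kernel evaluated at `f X`. -/
def CausalAlong {Ω α α' β : Type*} [MeasurableSpace Ω] [MeasurableSpace α] [MeasurableSpace α']
    [MeasurableSpace β] (X : Ω → α) (f : α → α') (Y : Ω → β) (γ : Measure Ω) : Prop :=
  ∃ k : Kernel α' β, IsMarkovKernel k ∧ ∀ (A : Set α) (B : Set β), MeasurableSet A →
    MeasurableSet B → γ (X ⁻¹' A ∩ Y ⁻¹' B) = ∫⁻ z in X ⁻¹' A, k (f (X z)) B ∂γ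

section CausalAlong

variable {Ω Ω' α α' β : Type*} {mΩ : MeasurableSpace Ω} [MeasurableSpace Ω'] [MeasurableSpace α]
  [MeasurableSpace α'] [MeasurableSpace β] {X : Ω → α} {f : α → α'} {Y : Ω → β}

lemma causalAlong_of_condExp [StandardBorelSpace β] [Nonempty β]
    {γ : Measure Ω} [IsFiniteMeasure γ] (hX : Measurable X) (hf : Measurable f) (hY : Measurable Y)
    (H : ∀ B : Set β, MeasurableSet B →
      γ⟦Y ⁻¹' B | MeasurableSpace.comap X inferInstance⟧ =ᵐ[γ]
      γ⟦Y ⁻¹' B | MeasurableSpace.comap (fun z => f (X z)) inferInstance⟧) :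
    CausalAlong X f Y γ := by
  refine ⟨condDistrib Y (fun z => f (X z)) γ, inferInstance, fun A B hA hB => ?_⟩
  rw [← setLIntegral_preimage_condDistrib hX hY.aemeasurable hB hA]
  refine lintegral_congr_ae (ae_restrict_of_ae ?_)
  filter_upwards [condDistrib_ae_eq_condExp (μ := γ) hX hY hB,
    condDistrib_ae_eq_condExp (μ := γ) (hf.comp hX) hY hB, H B hB] with z e1 e2 e3
  exact (measureReal_eq_measureReal_iff).1 ((e1.trans e3).trans e2.symm)

lemma condExp_ae_eq_of_kernel {γ : Measure Ω} [IsFiniteMeasure γ] (hX : Measurable X)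
    (hf : Measurable f) (hY : Measurable Y) {k : Kernel α' β} [IsMarkovKernel k]
    (hk : ∀ (A : Set α) (B : Set β), MeasurableSet A →
      MeasurableSet B → γ (X ⁻¹' A ∩ Y ⁻¹' B) = ∫⁻ z in X ⁻¹' A, k (f (X z)) B ∂γ)
    {B : Set β} (hB : MeasurableSet B) {m : MeasurableSpace Ω}
    (hm : m ≤ MeasurableSpace.comap X inferInstance) (hfm : Measurable[m] fun z => f (X z)) :
    (fun z => (k (f (X z))).real B) =ᵐ[γ] γ⟦Y ⁻¹' B | m⟧ := by
  have hkB : Measurable[mΩ] fun z => k (f (X z)) B := (k.measurable_coe hB).comp (hf.comp hX)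
  have hreal : Measurable[m] fun z => (k (f (X z))).real B :=
    (k.measurable_coe hB).ennreal_toReal.comp hfm
  have hm0 : m ≤ mΩ := hm.trans hX.comap_le
  refine ae_eq_condExp_of_forall_setIntegral_eq hm0 ?_ ?_ ?_ ?_
  · exact (integrable_const _).indicator (hY hB)
  · intro s _ _
    refine Integrable.integrableOn (Integrable.of_bound (C := 1)
      (hreal.mono hm0 le_rfl).aestronglyMeasurable (.of_forall fun z => ?_))
    rw [Real.norm_of_nonneg measureReal_nonneg]
    exact measureReal_le_one
  · intro s hs _
    obtain ⟨A, hA, rfl⟩ := hm s hs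
    simp_rw [measureReal_def]
    rw [integral_toReal hkB.aemeasurable (.of_forall fun z => measure_lt_top _ _), ← hk A B hA hB,
      integral_indicator (hY hB), setIntegral_const, measureReal_restrict_apply (hY hB),
      Set.inter_comm, smul_eq_mul, mul_one, measureReal_def]
  · exact hreal.stronglyMeasurable.aestronglyMeasurable

lemma CausalAlong.condExp_ae_eq {γ : Measure Ω} [IsFiniteMeasure γ] (hγ : CausalAlong X f Y γ)
    (hX : Measurable X) (hf : Measurable f) (hY : Measurable Y) {B : Set β}
    (hB : MeasurableSet B) :
    γ⟦Y ⁻¹' B | MeasurableSpace.comap X inferInstance⟧ =ᵐ[γ]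
      γ⟦Y ⁻¹' B | MeasurableSpace.comap (fun z => f (X z)) inferInstance⟧ := by
  obtain ⟨k, _, hk⟩ := hγ
  refine (condExp_ae_eq_of_kernel hX hf hY hk hB le_rfl ?_).symm.trans
    (condExp_ae_eq_of_kernel hX hf hY hk hB ?_ (comap_measurable _))
  · exact hf.comp (comap_measurable _)
  · rw [← Function.comp_def, ← MeasurableSpace.comap_comp]
    exact MeasurableSpace.comap_mono hf.comap_le

lemma causalAlong_map_iff {T : Ω' → Ω} {γ : Measure Ω'} (hT : Measurable T) (hX : Measurable X)
    (hf : Measurable f) (hY : Measurable Y) :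
    CausalAlong X f Y (γ.map T) ↔ CausalAlong (fun z => X (T z)) f (fun z => Y (T z)) γ := by
  refine exists_congr fun k => and_congr_right fun _ => forall₄_congr fun A B hA hB => ?_
  rw [Measure.map_apply hT ((hX hA).inter (hY hB)), Measure.restrict_map hT (hX hA),
    lintegral_map (f := fun z => k (f (X z)) B) ((k.measurable_coe hB).comp (hf.comp hX)) hT]
  rfl

lemma causalAlong_self (γ : Measure Ω) (hX : Measurable X) (hf : Measurable f) :
    CausalAlong X f (fun z => f (X z)) γ := by
  refine ⟨Kernel.id, inferInstance, fun A B hA hB => ?_⟩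
  have hfX : MeasurableSet ((fun z => f (X z)) ⁻¹' B) := (hf.comp hX) hB
  simp only [Kernel.id_apply, Measure.dirac_apply' _ hB]
  change _ = ∫⁻ z in X ⁻¹' A, ((fun z => f (X z)) ⁻¹' B).indicator 1 z ∂γ
  rw [lintegral_indicator_one hfX, Measure.restrict_apply hfX, Set.inter_comm]

lemma causalAlong_of_indepFun {γ : Measure Ω} [IsProbabilityMeasure γ] (h : IndepFun X Y γ)
    (hY : Measurable Y) : CausalAlong X f Y γ := by
  have := Measure.isProbabilityMeasure_map (μ := γ) hY.aemeasurable
  refine ⟨Kernel.const _ (γ.map Y), inferInstance, fun A B hA hB => ?_⟩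
  rw [h.measure_inter_preimage_eq_mul _ _ hA hB]
  simp [Measure.map_apply hY hB, mul_comm]

lemma setLIntegral_preimage_eq_of_kernel {γ : Measure Ω} (hX : Measurable X) (hf : Measurable f)
    (hY : Measurable Y) {k : Kernel α' β}
    (hk : ∀ (A : Set α) (B : Set β), MeasurableSet A →
      MeasurableSet B → γ (X ⁻¹' A ∩ Y ⁻¹' B) = ∫⁻ z in X ⁻¹' A, k (f (X z)) B ∂γ)
    {A : Set α} (hA : MeasurableSet A) {F : β → ℝ≥0∞} (hF : Measurable F) :
    ∫⁻ z in X ⁻¹' A, F (Y z) ∂γ = ∫⁻ z in X ⁻¹' A, ∫⁻ b, F b ∂(k (f (X z))) ∂γ := by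
  have hkX : Measurable fun z => k (f (X z)) := k.measurable.comp (hf.comp hX)
  have key : (γ.restrict (X ⁻¹' A)).map Y = (γ.restrict (X ⁻¹' A)).bind (fun z => k (f (X z))) := by
    ext B hB
    rw [Measure.map_apply hY hB, Measure.bind_apply hB hkX.aemeasurable,
      Measure.restrict_apply (hY hB), ← hk A B hA hB, Set.inter_comm]
  rw [← lintegral_map hF hY, key, Measure.lintegral_bind hkX.aemeasurable hF.aemeasurable]

end CausalAlong

section Glue

variable {α β δ α' β' δ' : Type*} [MeasurableSpace α] [MeasurableSpace β] [MeasurableSpace δ]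
  [MeasurableSpace α'] [MeasurableSpace β'] [MeasurableSpace δ']
  {f : α → α'} {g : β → β'} {h : δ → δ'}

section Marginals

variable (η : Measure β) [SFinite η] (κ₁ : Kernel β α) (κ₂ : Kernel β δ) [IsMarkovKernel κ₁]
  [IsMarkovKernel κ₂]

lemma compProd_prod_map_fst : (η ⊗ₘ (κ₁ ×ₖ κ₂)).map (fun z => (z.1, z.2.1)) = η ⊗ₘ κ₁ := by
  conv_rhs => rw [← Kernel.fst_prod κ₁ κ₂, Kernel.fst_eq, Measure.compProd_map measurable_fst]
  simp only [Prod.map_def, id]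

lemma compProd_prod_map_snd : (η ⊗ₘ (κ₁ ×ₖ κ₂)).map (fun z => (z.1, z.2.2)) = η ⊗ₘ κ₂ := by
  conv_rhs => rw [← Kernel.snd_prod κ₁ κ₂, Kernel.snd_eq, Measure.compProd_map measurable_snd]
  simp only [Prod.map_def, id]

lemma compProd_prod_map_swap :
    (η ⊗ₘ (κ₁ ×ₖ κ₂)).map (fun z => (z.1, z.2.swap)) = η ⊗ₘ (κ₂ ×ₖ κ₁) := by
  rw [← Kernel.map_prod_swap κ₁ κ₂, Measure.compProd_map measurable_swap]
  simp only [Prod.map_def, id]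

end Marginals

lemma CausalAlong.glue {η : Measure β} [IsFiniteMeasure η] {κ₁ : Kernel β α} {κ₂ : Kernel β δ}
    [IsMarkovKernel κ₁] [IsMarkovKernel κ₂] (hf : Measurable f) (hg : Measurable g)
    (hh : Measurable h) (h₁ : CausalAlong Prod.snd f (fun z => g z.1) (η ⊗ₘ κ₁))
    (h₂ : CausalAlong Prod.fst g (fun z => h z.2) (η ⊗ₘ κ₂)) :
    CausalAlong (fun z => z.2.1) f (fun z => h z.2.2) (η ⊗ₘ (κ₁ ×ₖ κ₂)) := by
  obtain ⟨k₁, _, hk₁⟩ := h₁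
  obtain ⟨k₂, _, hk₂⟩ := h₂
  refine ⟨k₂ ∘ₖ k₁, inferInstance, fun A B hA hB => ?_⟩
  have hF : Measurable fun b => k₂ b B := k₂.measurable_coe hB
  have hae : (fun y => κ₂ y (h ⁻¹' B)) =ᵐ[η] fun y => k₂ (g y) B := by
    refine ae_eq_of_forall_setLIntegral_eq_of_sigmaFinite (κ₂.measurable_coe (hh hB))
      (hF.comp hg) fun C hC _ => ?_
    rw [← Measure.compProd_apply_prod hC (hh hB)]
    refine (hk₂ C B hC hB).trans ?_
    conv_rhs => rw [← Measure.fst_compProd η κ₂, Measure.fst,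
      Measure.restrict_map measurable_fst hC,
      lintegral_map (f := fun y => k₂ (g y) B) (hF.comp hg) measurable_fst]
  have hsnd : (Prod.snd : β × α → α) ⁻¹' A = Set.univ ×ˢ A := by ext; simp
  have hrect : (fun z : β × α × δ => z.2.1) ⁻¹' A ∩ (fun z => h z.2.2) ⁻¹' B =
      Set.univ ×ˢ (A ×ˢ (h ⁻¹' B)) := by ext; simp
  have hm : Measurable fun x => (k₂ ∘ₖ k₁) (f x) B := ((k₂ ∘ₖ k₁).measurable_coe hB).comp hf
  calc (η ⊗ₘ (κ₁ ×ₖ κ₂)) ((fun z => z.2.1) ⁻¹' A ∩ (fun z => h z.2.2) ⁻¹' B)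
      = ∫⁻ y, κ₁ y A * κ₂ y (h ⁻¹' B) ∂η := by
        rw [hrect, Measure.compProd_apply_prod .univ (hA.prod (hh hB))]
        simp [Kernel.prod_apply_prod]
    _ = ∫⁻ y, κ₁ y A * k₂ (g y) B ∂η :=
        lintegral_congr_ae (hae.mono fun y hy => congrArg (κ₁ y A * ·) hy)
    _ = ∫⁻ z in Prod.snd ⁻¹' A, k₂ (g z.1) B ∂(η ⊗ₘ κ₁) := by
        rw [hsnd, Measure.setLIntegral_compProd (f := fun z => k₂ (g z.1) B)
          (hF.comp (hg.comp measurable_fst)) .univ hA]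
        simp [mul_comm]
    _ = ∫⁻ z in Prod.snd ⁻¹' A, (k₂ ∘ₖ k₁) (f z.2) B ∂(η ⊗ₘ κ₁) := by
        rw [setLIntegral_preimage_eq_of_kernel (Y := fun z : β × α => g z.1) measurable_snd hf
          (hg.comp measurable_fst) hk₁ hA hF]
        simp_rw [Kernel.comp_apply' _ _ _ hB]
    _ = ∫⁻ z in (fun z => z.2.1) ⁻¹' A, (k₂ ∘ₖ k₁) (f z.2.1) B ∂(η ⊗ₘ (κ₁ ×ₖ κ₂)) := by
        rw [← compProd_prod_map_fst η κ₁ κ₂,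
          Measure.restrict_map (by fun_prop) (measurable_snd hA),
          lintegral_map (f := fun z : β × α => (k₂ ∘ₖ k₁) (f z.2) B) (hm.comp measurable_snd)
            (by fun_prop)]
        rfl

end Glue

section Bicausal

variable {N : ℕ}

lemma measurable_proj (N t : ℕ) (ht : t ≤ N) : Measurable (proj N t ht) :=
  measurable_pi_lambda _ fun _ => measurable_pi_apply _

/-- Bicausality is causality in both directions, expressed through kernels. -/
lemma bicausal_iff {γ : Measure ((Fin N → ℝ) × (Fin N → ℝ))} [IsFiniteMeasure γ] :
    Bicausal N γ ↔ ∀ (t : ℕ) (ht : t < N),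
      CausalAlong Prod.fst (proj N t ht.le) (fun z => proj N t ht.le z.2) γ ∧
      CausalAlong Prod.snd (proj N t ht.le) (fun z => proj N t ht.le z.1) γ := by
  have hp := fun t (ht : t < N) => measurable_proj N t ht.le
  refine ⟨fun H t ht => ⟨?_, ?_⟩, fun H t ht B hB => ⟨?_, ?_⟩⟩
  · exact causalAlong_of_condExp measurable_fst (hp t ht) ((hp t ht).comp measurable_snd)
      fun B hB => (H t ht B hB).1
  · exact causalAlong_of_condExp measurable_snd (hp t ht) ((hp t ht).comp measurable_fst)
      fun B hB => (H t ht B hB).2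
  · exact (H t ht).1.condExp_ae_eq measurable_fst (hp t ht) ((hp t ht).comp measurable_snd) hB
  · exact (H t ht).2.condExp_ae_eq measurable_snd (hp t ht) ((hp t ht).comp measurable_fst) hB

end Bicausal

lemma coupling_swap {α β : Type*} [MeasurableSpace α] [MeasurableSpace β] {μ : Measure α}
    {ν : Measure β} {γ : Measure (α × β)} (hγ : γ ∈ coupling μ ν) :
    γ.map Prod.swap ∈ coupling ν μ := by
  obtain ⟨h1, h2⟩ := hγ
  constructor
  · rw [Measure.map_map measurable_fst measurable_swap]; exact h2
  · rw [Measure.map_map measurable_snd measurable_swap]; exact h1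

section EqOfCoupling

variable {X : Type*} [PseudoMetricSpace X] [MeasurableSpace X] [BorelSpace X]
  {μ ν : Measure X}

lemma measure_closed_le_of_coupling [IsFiniteMeasure ν]
    (H : ∀ δ > 0, ∀ ε > 0, ∃ γ ∈ coupling μ ν, γ {z | δ ≤ dist z.1 z.2} ≤ ε)
    {F : Set X} (hF : IsClosed F) : μ F ≤ ν F := by
  have key : ∀ δ > 0, μ F ≤ ν (Metric.thickening δ F) := by
    intro δ hδ
    refine ENNReal.le_of_forall_pos_le_add fun ε hε _ => ?_
    obtain ⟨γ, ⟨rfl, rfl⟩, hγ⟩ := H δ hδ ε (by exact_mod_cast hε)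
    rw [Measure.map_apply measurable_fst hF.measurableSet,
      Measure.map_apply measurable_snd Metric.isOpen_thickening.measurableSet]
    refine (measure_mono fun z hz => ?_).trans ((measure_union_le _ _).trans
      (add_le_add_right hγ _))
    by_cases h : δ ≤ dist z.1 z.2
    · exact Or.inr h
    · refine Or.inl (Metric.mem_thickening_iff.2 ⟨z.1, hz, ?_⟩)
      rw [dist_comm]
      exact not_le.1 h
  refine ge_of_tendsto (tendsto_measure_thickening_of_isClosed
    ⟨1, one_pos, measure_ne_top _ _⟩ hF) ?_
  filter_upwards [self_mem_nhdsWithin] with δ hδ using key δ hδ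

lemma eq_of_coupling [IsFiniteMeasure μ] [IsFiniteMeasure ν]
    (H : ∀ δ > 0, ∀ ε > 0, ∃ γ ∈ coupling μ ν, γ {z | δ ≤ dist z.1 z.2} ≤ ε) : μ = ν := by
  have H' : ∀ δ > 0, ∀ ε > 0, ∃ γ ∈ coupling ν μ, γ {z | δ ≤ dist z.1 z.2} ≤ ε := by
    intro δ hδ ε hε
    obtain ⟨γ, hγ, h⟩ := H δ hδ ε hε
    refine ⟨γ.map Prod.swap, coupling_swap hγ, ?_⟩
    change γ.map (MeasurableEquiv.prodComm (α := X) (β := X)) _ ≤ ε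
    rw [MeasurableEquiv.map_apply]
    refine (measure_mono fun z hz => ?_).trans h
    exact hz.trans_eq (dist_comm z.2 z.1)
  have hcl : ∀ F : Set X, IsClosed F → μ F = ν F := fun F hF =>
    le_antisymm (measure_closed_le_of_coupling H hF) (measure_closed_le_of_coupling H' hF)
  exact ext_of_generate_finite {s | IsClosed s}
    ((BorelSpace.measurable_eq).trans borel_eq_generateFrom_isClosed)
    (fun s hs t ht _ => IsClosed.inter hs ht) hcl (hcl _ isClosed_univ)

end EqOfCoupling

lemma topology_eq_of_seq {X : Type*} {t₁ t₂ : TopologicalSpace X} (h₁ : @SequentialSpace X t₁)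
    (h₂ : @SequentialSpace X t₂)
    (h : ∀ (u : ℕ → X) (x : X), Tendsto u atTop (@nhds X t₁ x) ↔ Tendsto u atTop (@nhds X t₂ x)) :
    t₁ = t₂ := by
  refine le_antisymm ?_ ?_
  · rw [← continuous_id_iff_le]
    exact @SeqContinuous.continuous X X t₁ t₂ h₁ _ fun u x hu => (h u x).1 hu
  · rw [← continuous_id_iff_le]
    exact @SeqContinuous.continuous X X t₂ t₁ h₂ _ fun u x hu => (h u x).2 hu

section TopologyEq

variable {X : Type*} [t : TopologicalSpace X] [SecondCountableTopology X] [MeasurableSpace X]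
  [BorelSpace X]

lemma measurable_dist_of_topology_eq (m : PseudoMetricSpace X)
    (h : t = m.toUniformSpace.toTopologicalSpace) :
    Measurable fun z : X × X => m.dist z.1 z.2 := by
  subst h
  exact continuous_dist.measurable

lemma eq_of_coupling_pi (m : PseudoMetricSpace X)
    (h : t = m.toUniformSpace.toTopologicalSpace) {ι : Type*} [Fintype ι] {μ ν : Measure (ι → X)}
    [IsFiniteMeasure μ] [IsFiniteMeasure ν]
    (H : ∀ δ > 0, ∀ ε > 0, ∃ γ ∈ coupling μ ν, γ {z | ∃ i, δ ≤ m.dist (z.1 i) (z.2 i)} ≤ ε) :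
    μ = ν := by
  subst h
  refine eq_of_coupling fun δ hδ ε hε => ?_
  obtain ⟨γ, hγ, h⟩ := H δ hδ ε hε
  refine ⟨γ, hγ, (measure_mono fun z hz => ?_).trans h⟩
  by_contra hcon
  exact absurd hz (not_le.2 ((dist_pi_lt_iff hδ).2 fun i => not_le.1 fun hi => hcon ⟨i, hi⟩))

end TopologyEq

namespace IsCompatibleMetric

variable {dund : ℝ → ℝ → ℝ}

lemma nonneg (hd : IsCompatibleMetric dund) (x y : ℝ) : 0 ≤ dund x y := by
  have := hd.triangle x y x
  rw [hd.self_eq_zero, hd.symm y x] at this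
  linarith

/-- The pseudometric on the real line given by `dund`. -/
abbrev toPseudoMetricSpace (hd : IsCompatibleMetric dund) : PseudoMetricSpace ℝ where
  dist := dund
  dist_self := hd.self_eq_zero
  dist_comm := hd.symm
  dist_triangle := hd.triangle

lemma topology_eq (hd : IsCompatibleMetric dund) :
    (inferInstance : TopologicalSpace ℝ) =
      hd.toPseudoMetricSpace.toUniformSpace.toTopologicalSpace := by
  have hseq (X : Type) [PseudoMetricSpace X] : SequentialSpace X := inferInstance
  refine topology_eq_of_seq (hseq ℝ) (@hseq ℝ hd.toPseudoMetricSpace) fun u x => ?_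
  rw [hd.compatible]
  exact (@tendsto_iff_dist_tendsto_zero ℝ ℕ hd.toPseudoMetricSpace _ _ _).symm

lemma measurable (hd : IsCompatibleMetric dund) : Measurable fun z : ℝ × ℝ => dund z.1 z.2 :=
  measurable_dist_of_topology_eq hd.toPseudoMetricSpace hd.topology_eq

lemma eq_of_coupling (hd : IsCompatibleMetric dund) {N : ℕ} {μ ν : Measure (Fin N → ℝ)}
    [IsFiniteMeasure μ] [IsFiniteMeasure ν]
    (H : ∀ δ > 0, ∀ ε > 0, ∃ γ ∈ coupling μ ν, γ {z | ∃ t, δ ≤ dund (z.1 t) (z.2 t)} ≤ ε) :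
    μ = ν :=
  eq_of_coupling_pi hd.toPseudoMetricSpace hd.topology_eq H

end IsCompatibleMetric

section BicausalCouplings

variable {N : ℕ} {μ ν η : Measure (Fin N → ℝ)}

lemma isProbabilityMeasure_of_mem_coupling {α β : Type*} [MeasurableSpace α] [MeasurableSpace β]
    {μ : Measure α} {ν : Measure β} [IsProbabilityMeasure μ] {γ : Measure (α × β)}
    (hγ : γ ∈ coupling μ ν) : IsProbabilityMeasure γ := by
  have : IsProbabilityMeasure (γ.map Prod.fst) := by rw [hγ.1]; infer_instance
  exact Measure.isProbabilityMeasure_of_map Prod.fst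

lemma Bicausal.swap {γ : Measure ((Fin N → ℝ) × (Fin N → ℝ))} [IsFiniteMeasure γ]
    (hγ : Bicausal N γ) : Bicausal N (γ.map Prod.swap) := by
  rw [bicausal_iff] at hγ ⊢
  intro t ht
  have hp := measurable_proj N t ht.le
  exact ⟨(causalAlong_map_iff measurable_swap measurable_fst hp (hp.comp measurable_snd)).2
    (hγ t ht).2, (causalAlong_map_iff measurable_swap measurable_snd hp
      (hp.comp measurable_fst)).2 (hγ t ht).1⟩

lemma prod_mem_coupling [IsProbabilityMeasure μ] [IsProbabilityMeasure ν] :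
    μ.prod ν ∈ coupling μ ν := by
  simp [coupling]

lemma bicausal_prod [IsProbabilityMeasure μ] [IsProbabilityMeasure ν] :
    Bicausal N (μ.prod ν) := by
  rw [bicausal_iff]
  intro t ht
  have hp := measurable_proj N t ht.le
  exact ⟨causalAlong_of_indepFun (indepFun_prod measurable_id hp) (hp.comp measurable_snd),
    causalAlong_of_indepFun (indepFun_prod hp measurable_id).symm (hp.comp measurable_fst)⟩

lemma diag_mem_coupling : μ.map (fun x => (x, x)) ∈ coupling μ μ := by
  have hd : Measurable fun x : Fin N → ℝ => (x, x) := by fun_prop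
  constructor
  · rw [Measure.map_map measurable_fst hd]; exact Measure.map_id
  · rw [Measure.map_map measurable_snd hd]; exact Measure.map_id

lemma bicausal_diag [IsFiniteMeasure μ] : Bicausal N (μ.map fun x => (x, x)) := by
  rw [bicausal_iff]
  intro t ht
  have hd : Measurable fun x : Fin N → ℝ => (x, x) := by fun_prop
  have hp := measurable_proj N t ht.le
  exact ⟨(causalAlong_map_iff hd measurable_fst hp (hp.comp measurable_snd)).2
    (causalAlong_self μ measurable_id hp), (causalAlong_map_iff hd measurable_snd hp
      (hp.comp measurable_fst)).2 (causalAlong_self μ measurable_id hp)⟩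

/-- Two bicausal couplings sharing the marginal `η` can be glued over `η`. -/
lemma exists_gluing [IsProbabilityMeasure η] {γ₁ γ₂ : Measure ((Fin N → ℝ) × (Fin N → ℝ))}
    (h₁ : γ₁ ∈ coupling μ η) (hb₁ : Bicausal N γ₁) (h₂ : γ₂ ∈ coupling η ν)
    (hb₂ : Bicausal N γ₂) :
    ∃ ρ : Measure ((Fin N → ℝ) × (Fin N → ℝ) × (Fin N → ℝ)),
      ρ.map (fun z => (z.2.1, z.1)) = γ₁ ∧ ρ.map (fun z => (z.1, z.2.2)) = γ₂ ∧
      Bicausal N (ρ.map Prod.snd) := by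
  have hs₁ := coupling_swap h₁
  have := isProbabilityMeasure_of_mem_coupling hs₁
  have := isProbabilityMeasure_of_mem_coupling h₂
  have hγ₁ : γ₁ = (γ₁.map Prod.swap).map Prod.swap := by
    rw [Measure.map_map measurable_swap measurable_swap, Prod.swap_swap_eq, Measure.map_id]
  have : IsFiniteMeasure γ₁ := hγ₁ ▸ inferInstance
  set κ₁ := (γ₁.map Prod.swap).condKernel
  set κ₂ := γ₂.condKernel
  have e₁ : η ⊗ₘ κ₁ = γ₁.map Prod.swap := by
    rw [← Measure.disintegrate (γ₁.map Prod.swap) κ₁, Measure.fst, hs₁.1]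
  have e₂ : η ⊗ₘ κ₂ = γ₂ := by
    rw [← Measure.disintegrate γ₂ κ₂, Measure.fst, h₂.1]
  have hc₁ := bicausal_iff.1 hb₁.swap
  have hc₂ := bicausal_iff.1 hb₂
  rw [← e₁] at hc₁
  rw [← e₂] at hc₂
  refine ⟨η ⊗ₘ (κ₁ ×ₖ κ₂), ?_, ?_, ?_⟩
  · rw [hγ₁, ← e₁, ← compProd_prod_map_fst η κ₁ κ₂,
      Measure.map_map measurable_swap (by fun_prop)]
    rfl
  · rw [compProd_prod_map_snd, e₂]
  · rw [bicausal_iff]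
    intro t ht
    have hp := measurable_proj N t ht.le
    refine ⟨(causalAlong_map_iff measurable_snd measurable_fst hp (hp.comp measurable_snd)).2
      (CausalAlong.glue hp hp hp (hc₁ t ht).2 (hc₂ t ht).1),
      (causalAlong_map_iff measurable_snd measurable_snd hp (hp.comp measurable_fst)).2 ?_⟩
    have hglue := CausalAlong.glue hp hp hp (hc₂ t ht).2 (hc₁ t ht).1
    rw [← compProd_prod_map_swap η κ₁ κ₂] at hglue
    have hsnd : Measurable fun z : (Fin N → ℝ) × (Fin N → ℝ) × (Fin N → ℝ) =>
        proj N t ht.le z.2.2 := hp.comp (by fun_prop)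
    have hunswap := (causalAlong_map_iff (by fun_prop) (by fun_prop) hp hsnd).1 hglue
    exact hunswap

end BicausalCouplings

section Cost

variable {N : ℕ} {p : ℝ} {dund : ℝ → ℝ → ℝ} {μ ν η : Measure (Fin N → ℝ)}

lemma ofReal_costp (hp : 1 ≤ p) (hd : IsCompatibleMetric dund) (x y : Fin N → ℝ) :
    ENNReal.ofReal (costp N p dund (x, y)) = ∑ t, ENNReal.ofReal (dund (x t) (y t)) ^ p := by
  rw [costp, ENNReal.ofReal_sum_of_nonneg fun t _ => Real.rpow_nonneg (hd.nonneg _ _) _]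
  exact Finset.sum_congr rfl fun t _ =>
    (ENNReal.ofReal_rpow_of_nonneg (hd.nonneg _ _) (by linarith)).symm

lemma costp_swap (hd : IsCompatibleMetric dund) (z : (Fin N → ℝ) × (Fin N → ℝ)) :
    costp N p dund z.swap = costp N p dund z :=
  Finset.sum_congr rfl fun _ _ => by rw [hd.symm]; rfl

lemma measurable_costp (hd : IsCompatibleMetric dund) : Measurable (costp N p dund) := by
  refine Finset.measurable_sum _ fun t _ => Measurable.pow_const ?_ p
  exact hd.measurable.comp (f := fun z : (Fin N → ℝ) × (Fin N → ℝ) => (z.1 t, z.2 t))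
    (by fun_prop)

lemma measurable_ofReal_costp (hd : IsCompatibleMetric dund) :
    Measurable fun z => ENNReal.ofReal (costp N p dund z) :=
  (measurable_costp hd).ennreal_ofReal

lemma costp_triangle (hp : 1 ≤ p) (hd : IsCompatibleMetric dund) (x y z : Fin N → ℝ) :
    ENNReal.ofReal (costp N p dund (x, z)) ^ (1 / p) ≤
      ENNReal.ofReal (costp N p dund (x, y)) ^ (1 / p) +
        ENNReal.ofReal (costp N p dund (y, z)) ^ (1 / p) := by
  simp only [ofReal_costp hp hd]
  refine le_trans ?_ (ENNReal.Lp_add_le _ _ _ hp)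
  gcongr with t
  rw [← ENNReal.ofReal_add (hd.nonneg _ _) (hd.nonneg _ _)]
  exact ENNReal.ofReal_le_ofReal (hd.triangle _ _ _)

lemma nestedDist_eq_iInf (hp : 1 ≤ p) : nestedDist N p dund μ ν =
    ⨅ γ : {γ : Measure ((Fin N → ℝ) × (Fin N → ℝ)) // γ ∈ coupling μ ν ∧ Bicausal N γ},
      (∫⁻ z, ENNReal.ofReal (costp N p dund z) ∂(γ : Measure _)) ^ (1 / p) :=
  (ENNReal.orderIsoRpow (1 / p) (by positivity)).map_iInf _

lemma nestedDist_le (hp : 1 ≤ p) {γ : Measure ((Fin N → ℝ) × (Fin N → ℝ))}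
    (hγ : γ ∈ coupling μ ν) (hb : Bicausal N γ) : nestedDist N p dund μ ν ≤
      (∫⁻ z, ENNReal.ofReal (costp N p dund z) ∂γ) ^ (1 / p) := by
  rw [nestedDist_eq_iInf hp]
  exact iInf_le_of_le ⟨γ, hγ, hb⟩ le_rfl

lemma nestedDist_triangle (hp : 1 ≤ p) (hd : IsCompatibleMetric dund) [IsProbabilityMeasure η] :
    nestedDist N p dund μ ν ≤ nestedDist N p dund μ η + nestedDist N p dund η ν := by
  have hp0 : p ≠ 0 := by linarith
  have hc := measurable_ofReal_costp (N := N) (p := p) hd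
  rw [nestedDist_eq_iInf (μ := μ) (ν := η) hp, nestedDist_eq_iInf (μ := η) (ν := ν) hp,
    ENNReal.iInf_add]
  refine le_iInf fun γ₁ => ?_
  rw [ENNReal.add_iInf]
  refine le_iInf fun γ₂ => ?_
  obtain ⟨γ₁, h₁, hb₁⟩ := γ₁
  obtain ⟨γ₂, h₂, hb₂⟩ := γ₂
  obtain ⟨ρ, rfl, rfl, hb⟩ := exists_gluing h₁ hb₁ h₂ hb₂
  have hmem : ρ.map Prod.snd ∈ coupling μ ν := by
    have m1 := h₁.1
    have m2 := h₂.2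
    rw [Measure.map_map measurable_fst (by fun_prop)] at m1
    rw [Measure.map_map measurable_snd (by fun_prop)] at m2
    constructor
    · rw [Measure.map_map measurable_fst measurable_snd]; exact m1
    · rw [Measure.map_map measurable_snd measurable_snd]; exact m2
  refine (nestedDist_le hp hmem hb).trans ?_
  dsimp only
  rw [lintegral_map hc measurable_snd, lintegral_map hc (by fun_prop),
    lintegral_map hc (by fun_prop)]
  have hrpow : ∀ a : ℝ≥0∞, a = (a ^ (1 / p)) ^ p := fun a => by
    rw [← ENNReal.rpow_mul, one_div_mul_cancel hp0, ENNReal.rpow_one]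
  have mink := ENNReal.lintegral_Lp_add_le (μ := ρ) (p := p)
    (f := fun z => ENNReal.ofReal (costp N p dund (z.2.1, z.1)) ^ (1 / p))
    (g := fun z => ENNReal.ofReal (costp N p dund (z.1, z.2.2)) ^ (1 / p))
    ((hc.comp (by fun_prop)).pow_const _).aemeasurable
    ((hc.comp (by fun_prop)).pow_const _).aemeasurable hp
  simp only [← hrpow] at mink
  refine le_trans ?_ mink
  gcongr with z
  refine (hrpow _).trans_le ?_
  gcongr
  exact costp_triangle hp hd _ _ _

lemma nestedDist_swap_le (hp : 1 ≤ p) (hd : IsCompatibleMetric dund) [IsProbabilityMeasure μ] :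
    nestedDist N p dund ν μ ≤ nestedDist N p dund μ ν := by
  rw [nestedDist_eq_iInf (μ := μ) (ν := ν) hp]
  refine le_iInf fun ⟨γ, hγ, hb⟩ => ?_
  have := isProbabilityMeasure_of_mem_coupling hγ
  refine (nestedDist_le hp (coupling_swap hγ) hb.swap).trans_eq ?_
  rw [lintegral_map (measurable_ofReal_costp hd) measurable_swap]
  simp only [costp_swap hd]

lemma nestedDist_self (hp : 1 ≤ p) (hd : IsCompatibleMetric dund) [IsFiniteMeasure μ] :
    nestedDist N p dund μ μ = 0 := by
  have hp0 : 0 < p := by linarith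
  refine le_antisymm ((nestedDist_le hp diag_mem_coupling bicausal_diag).trans_eq ?_) zero_le
  rw [lintegral_map (measurable_ofReal_costp hd) (by fun_prop)]
  simp [costp, hd.self_eq_zero, Real.zero_rpow hp0.ne', hp0]

lemma eq_of_nestedDist_eq_zero (hp : 1 ≤ p) (hd : IsCompatibleMetric dund) [IsFiniteMeasure μ]
    [IsFiniteMeasure ν] (h : nestedDist N p dund μ ν = 0) : μ = ν := by
  have hp0 : 0 < p := by linarith
  rw [nestedDist, ENNReal.rpow_eq_zero_iff_of_pos (by positivity)] at h
  refine hd.eq_of_coupling fun δ hδ ε hε => ?_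
  have hc0 : ENNReal.ofReal (δ ^ p) ≠ 0 := by simpa using Real.rpow_pos_of_pos hδ p
  obtain ⟨⟨γ, hγ, hb⟩, hlt⟩ := iInf_lt_iff.1
    (h.trans_lt (pos_iff_ne_zero.2 (mul_ne_zero hc0 hε.ne')))
  refine ⟨γ, hγ, ?_⟩
  rw [← ENNReal.mul_le_mul_iff_right hc0 ENNReal.ofReal_ne_top]
  refine le_trans ?_ hlt.le
  refine le_trans ?_ (mul_meas_ge_le_lintegral (measurable_ofReal_costp hd)
    (ENNReal.ofReal (δ ^ p)))
  refine mul_le_mul_right (measure_mono ?_) _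
  rintro z ⟨t, ht⟩
  refine ENNReal.ofReal_le_ofReal ((Real.rpow_le_rpow hδ.le ht hp0.le).trans ?_)
  exact Finset.single_le_sum (f := fun t => dund (z.1 t) (z.2 t) ^ p)
    (fun t _ => Real.rpow_nonneg (hd.nonneg _ _) p) (Finset.mem_univ t)

lemma nestedDist_dirac_ne_top (hp : 1 ≤ p) (hd : IsCompatibleMetric dund) [IsProbabilityMeasure μ]
    {x₀ : Fin N → ℝ} (h : ∫⁻ x, ENNReal.ofReal (costp N p dund (x, x₀)) ∂μ ≠ ⊤) :
    nestedDist N p dund μ (Measure.dirac x₀) ≠ ⊤ := by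
  refine ne_top_of_le_ne_top ?_ (nestedDist_le hp prod_mem_coupling bicausal_prod)
  rw [lintegral_prod _ (measurable_ofReal_costp hd).aemeasurable]
  simp only [lintegral_dirac]
  exact ENNReal.rpow_ne_top_of_nonneg (by positivity) h

lemma nestedDist_ne_top (hp : 1 ≤ p) (hd : IsCompatibleMetric dund)
    (hμ : MemPp N p dund μ) (hν : MemPp N p dund ν) : nestedDist N p dund μ ν ≠ ⊤ := by
  obtain ⟨_, x₀, hx₀⟩ := hμ
  obtain ⟨_, y₀, hy₀⟩ := hν
  have h₁ := nestedDist_dirac_ne_top hp hd hx₀.ne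
  have h₂ : nestedDist N p dund (Measure.dirac x₀) (Measure.dirac y₀) ≠ ⊤ := by
    refine nestedDist_dirac_ne_top hp hd ?_
    rw [lintegral_dirac]
    exact ENNReal.ofReal_ne_top
  have h₃ : nestedDist N p dund (Measure.dirac y₀) ν ≠ ⊤ :=
    ne_top_of_le_ne_top (nestedDist_dirac_ne_top hp hd hy₀.ne) (nestedDist_swap_le hp hd)
  refine ne_top_of_le_ne_top ?_ (nestedDist_triangle (η := Measure.dirac y₀) hp hd)
  refine ENNReal.add_ne_top.2 ⟨?_, h₃⟩
  exact ne_top_of_le_ne_top (ENNReal.add_ne_top.2 ⟨h₁, h₂⟩)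
    (nestedDist_triangle (η := Measure.dirac x₀) hp hd)

end Cost

/-- for every `N ≥ 1` and `p ∈ [1,∞)`, the nested distance is a metric on
`𝒫^p(ℝ^N)`: finite, nonnegative, symmetric, vanishing exactly on the diagonal and
satisfying the triangle inequality. -/
theorem nestedDist_isMetric (N : ℕ) (hN : 1 ≤ N) (p : ℝ) (hp : 1 ≤ p)
    (dund : ℝ → ℝ → ℝ) (hd : IsCompatibleMetric dund)
    (μ ν η : Measure (Fin N → ℝ))
    (hμ : MemPp N p dund μ) (hν : MemPp N p dund ν) (hη : MemPp N p dund η) :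
    nestedDist N p dund μ ν ≠ ⊤ ∧
    0 ≤ nestedDist N p dund μ ν ∧
    nestedDist N p dund μ ν = nestedDist N p dund ν μ ∧
    (nestedDist N p dund μ ν = 0 ↔ μ = ν) ∧
    nestedDist N p dund μ ν ≤ nestedDist N p dund μ η + nestedDist N p dund η ν := by
  have := hμ.1
  have := hν.1
  have := hη.1
  refine ⟨nestedDist_ne_top hp hd hμ hν, zero_le,
    le_antisymm (nestedDist_swap_le hp hd) (nestedDist_swap_le hp hd),
    ⟨eq_of_nestedDist_eq_zero hp hd, ?_⟩, nestedDist_triangle hp hd⟩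
  rintro rfl
  exact nestedDist_self hp hd
end
end

section
/- Let N = 2, let d̲ be the usual distance on ℝ, and for n ≥ 1 set μ_n := (1/2)(δ_{(1/n,1)} + δ_{(−1/n,−1)}) ∈ 𝒫^p(ℝ²). Then d_p^nd(μ_n,μ_m) ≤ |1/n − 1/m| for all n, m, so (μ_n) is a Cauchy sequence for d_p^nd; but there exists no μ ∈ 𝒫^p(ℝ²) with d_p^nd(μ_n,μ) → 0. In particular the metric space (𝒫^p(ℝ²), d_p^nd) is not complete. -/
open MeasureTheory ProbabilityTheory Filter
open scoped ENNReal NNReal Topology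

noncomputable section

/-- A coupling `γ` on `ℝ² × ℝ²`, viewed as the joint law of two-stage processes
`X = (X₁,X₂)` and `Y = (Y₁,Y₂)`, is bicausal if for every Borel `B ⊆ ℝ` one has
`ℙ(Y₁ ∈ B | X₁,X₂) = ℙ(Y₁ ∈ B | X₁)` a.s. and `ℙ(X₁ ∈ B | Y₁,Y₂) = ℙ(X₁ ∈ B | Y₁)` a.s. -/
def Bicausal2 (γ : Measure ((ℝ × ℝ) × (ℝ × ℝ))) : Prop :=
  ∀ B : Set ℝ, MeasurableSet B →
    (γ[fun z => Set.indicator B (fun _ => (1 : ℝ)) z.2.1 |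
        MeasurableSpace.comap Prod.fst inferInstance]
      =ᵐ[γ]
     γ[fun z => Set.indicator B (fun _ => (1 : ℝ)) z.2.1 |
        MeasurableSpace.comap (fun z : (ℝ × ℝ) × (ℝ × ℝ) => z.1.1) inferInstance]) ∧
    (γ[fun z => Set.indicator B (fun _ => (1 : ℝ)) z.1.1 |
        MeasurableSpace.comap Prod.snd inferInstance]
      =ᵐ[γ]
     γ[fun z => Set.indicator B (fun _ => (1 : ℝ)) z.1.1 |
        MeasurableSpace.comap (fun z : (ℝ × ℝ) × (ℝ × ℝ) => z.2.1) inferInstance])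

/-- The `p`-th power cost `d(x,y)^p = d̲(x₁,y₁)^p + d̲(x₂,y₂)^p` on `ℝ² × ℝ²`. -/
def cost2 (p : ℝ) (dund : ℝ → ℝ → ℝ) (z : (ℝ × ℝ) × (ℝ × ℝ)) : ℝ≥0∞ :=
  ENNReal.ofReal (dund z.1.1 z.2.1 ^ p + dund z.1.2 z.2.2 ^ p)

/-- The nested distance `d_p^nd(μ,ν) = (inf_{γ ∈ Π_bc(μ,ν)} ∫ d^p dγ)^{1/p}` on `𝒫^p(ℝ²)`. -/
def nestedDist2 (p : ℝ) (dund : ℝ → ℝ → ℝ) (μ ν : Measure (ℝ × ℝ)) : ℝ≥0∞ :=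
  (⨅ γ : {γ : Measure ((ℝ × ℝ) × (ℝ × ℝ)) // γ ∈ coupling μ ν ∧ Bicausal2 γ},
      ∫⁻ z, cost2 p dund z ∂(γ : Measure _)) ^ (1 / p)

/-- Membership in `𝒫^p(ℝ²)`: a probability measure with a finite `p`-th moment. -/
def MemP2 (p : ℝ) (dund : ℝ → ℝ → ℝ) (μ : Measure (ℝ × ℝ)) : Prop :=
  IsProbabilityMeasure μ ∧
    ∃ x₀ : ℝ × ℝ, ∫⁻ x, cost2 p dund (x, x₀) ∂μ < ⊤

/-- The `p`-Wasserstein distance on measures on the line, w.r.t. the base metric `d̲`. -/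
def Wp (p : ℝ) (dund : ℝ → ℝ → ℝ) (m m' : Measure ℝ) : ℝ≥0∞ :=
  (⨅ η : {η : Measure (ℝ × ℝ) // η ∈ coupling m m'},
      ∫⁻ q : ℝ × ℝ, ENNReal.ofReal (dund q.1 q.2 ^ p) ∂(η : Measure (ℝ × ℝ))) ^ (1 / p)

/-- The regular conditional distribution of the second coordinate given the first
(with a junk value for non-finite measures). -/
def condK (μ : Measure (ℝ × ℝ)) : Kernel ℝ ℝ :=
  haveI := Classical.dec (IsFiniteMeasure μ)
  if h : IsFiniteMeasure μ then @Measure.condKernel ℝ ℝ _ _ _ _ μ h else 0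

/-- The cdf of a measure on the line. -/
def cdfE (η : Measure ℝ) (y : ℝ) : ℝ≥0∞ := η (Set.Iic y)

/-- The left-continuous generalized inverse `F_η^{-1}(u) = inf { y : F_η(y) ≥ u }`. -/
def quantile (η : Measure ℝ) (u : ℝ) : ℝ :=
  sInf {y : ℝ | ENNReal.ofReal u ≤ cdfE η y}

/-- The (increasing) Knothe–Rosenblatt rearrangement of `μ` and `ν`: the joint law of
`((X₁,X₂),(Y₁,Y₂))` where `X₁ = F_{μ₁}^{-1}(U₁)`, `Y₁ = F_{ν₁}^{-1}(U₁)`,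
`X₂ = F_{μ^{X₁}}^{-1}(U₂)`, `Y₂ = F_{ν^{Y₁}}^{-1}(U₂)` for independent uniforms `U₁, U₂`. -/
def KR (μ ν : Measure (ℝ × ℝ)) : Measure ((ℝ × ℝ) × (ℝ × ℝ)) :=
  ((volume.restrict (Set.Ioo (0 : ℝ) 1)).prod (volume.restrict (Set.Ioo (0 : ℝ) 1))).map
    (fun u =>
      ((quantile (μ.map Prod.fst) u.1,
        quantile (condK μ (quantile (μ.map Prod.fst) u.1)) u.2),
       (quantile (ν.map Prod.fst) u.1,
        quantile (condK ν (quantile (ν.map Prod.fst) u.1)) u.2)))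

/-- The Knothe–Rosenblatt distance `d_p^KR(μ,ν) = (∫ d^p dπ)^{1/p}`, `π` the KR
rearrangement of `μ` and `ν`. -/
def dKR (p : ℝ) (dund : ℝ → ℝ → ℝ) (μ ν : Measure (ℝ × ℝ)) : ℝ≥0∞ :=
  (∫⁻ z, cost2 p dund z ∂(KR μ ν)) ^ (1 / p)

/-- The uniform probability measure on two points (which may coincide). -/
def twoPoint {α : Type*} [MeasurableSpace α] (a b : α) : Measure α :=
  (2⁻¹ : ℝ≥0∞) • (Measure.dirac a + Measure.dirac b)

instance isProbabilityMeasure_twoPoint {α : Type*} [MeasurableSpace α] (a b : α) :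
    IsProbabilityMeasure (twoPoint a b) :=
  ⟨by simp [twoPoint, ENNReal.inv_two_add_inv_two]⟩

lemma map_twoPoint {α β : Type*} [MeasurableSpace α] [MeasurableSpace β] {f : α → β}
    (hf : Measurable f) (a b : α) : (twoPoint a b).map f = twoPoint (f a) (f b) := by
  simp [twoPoint, Measure.map_smul, Measure.map_add _ _ hf, Measure.map_dirac' hf]

lemma ae_twoPoint_iff {α : Type*} [MeasurableSpace α] [MeasurableSingletonClass α] {a b : α}
    {P : α → Prop} : (∀ᵐ x ∂twoPoint a b, P x) ↔ P a ∧ P b := by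
  rw [twoPoint, Measure.ae_ennreal_smul_measure_iff (by simp), ae_add_measure_iff]
  simp [ae_dirac_eq]

lemma lintegral_twoPoint {α : Type*} [MeasurableSpace α] [MeasurableSingletonClass α]
    (a b : α) (f : α → ℝ≥0∞) : ∫⁻ x, f x ∂twoPoint a b = 2⁻¹ * (f a + f b) := by
  simp [twoPoint, lintegral_add_measure, mul_add]

lemma measurable_cost2 (p : ℝ) : Measurable (cost2 p fun x y => |x - y|) := by
  unfold cost2
  fun_prop

lemma memP2_twoPoint (p : ℝ) (dund : ℝ → ℝ → ℝ) (a b : ℝ × ℝ) :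
    MemP2 p dund (twoPoint a b) := by
  refine ⟨inferInstance, 0, ?_⟩
  rw [lintegral_twoPoint]
  exact ENNReal.mul_lt_top (by simp) (by simp [cost2])

/-- If `f` is a.e. a function of `π ∘ X`, then conditioning it on `X` or on `π ∘ X` gives the same
result. -/
lemma condExp_comap_eq_of_ae_eq_comp {Ω E F : Type*} [mΩ : MeasurableSpace Ω]
    [MeasurableSpace E] [MeasurableSpace F] {γ : Measure Ω} [IsFiniteMeasure γ]
    {X : Ω → E} (hX : Measurable X) {π : E → F} (hπ : Measurable π)
    {f : Ω → ℝ} {g : F → ℝ} (hg : Measurable g) (hfg : f =ᵐ[γ] fun ω => g (π (X ω)))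
    (hf : Integrable f γ) :
    γ[f | MeasurableSpace.comap X inferInstance] =ᵐ[γ]
      γ[f | MeasurableSpace.comap (fun ω => π (X ω)) inferInstance] := by
  have hgm : Measurable[MeasurableSpace.comap (fun ω => π (X ω)) inferInstance]
      fun ω => g (π (X ω)) := hg.comp (comap_measurable _)
  have hle : MeasurableSpace.comap (fun ω => π (X ω)) inferInstance ≤
      MeasurableSpace.comap X inferInstance :=
    (hπ.comp (comap_measurable X)).comap_le
  have hgi := hf.congr hfg
  refine (condExp_congr_ae hfg).trans (EventuallyEq.trans ?_ (condExp_congr_ae hfg).symm)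
  rw [condExp_of_stronglyMeasurable hX.comap_le (hgm.mono hle le_rfl).stronglyMeasurable hgi,
    condExp_of_stronglyMeasurable (show Measurable fun ω => π (X ω) from hπ.comp hX).comap_le hgm.stronglyMeasurable hgi]

/-- A measure under which each of `X₁`, `Y₁` is a measurable function of the other is bicausal. -/
lemma bicausal2_of_ae_eq {γ : Measure ((ℝ × ℝ) × (ℝ × ℝ))} [IsFiniteMeasure γ] {f g : ℝ → ℝ}
    (hf : Measurable f) (hg : Measurable g) (hfγ : ∀ᵐ z ∂γ, z.2.1 = f z.1.1)
    (hgγ : ∀ᵐ z ∂γ, z.1.1 = g z.2.1) : Bicausal2 γ := by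
  intro B hB
  have hind : Measurable (B.indicator fun _ => (1 : ℝ)) := measurable_const.indicator hB
  have hbdd : ∀ h : (ℝ × ℝ) × (ℝ × ℝ) → ℝ, Measurable h →
      Integrable (fun z => B.indicator (fun _ => (1 : ℝ)) (h z)) γ := fun h hh =>
    Integrable.of_bound (hind.comp hh).aestronglyMeasurable 1
      (.of_forall fun z => by by_cases hz : h z ∈ B <;> simp [hz])
  constructor
  · refine condExp_comap_eq_of_ae_eq_comp (X := Prod.fst) (π := Prod.fst) measurable_fst
      measurable_fst (hind.comp hf) ?_ (hbdd _ (by fun_prop))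
    filter_upwards [hfγ] with z hz
    simp [hz]
  · refine condExp_comap_eq_of_ae_eq_comp (X := Prod.snd) (π := Prod.fst) measurable_snd
      measurable_fst (hind.comp hg) ?_ (hbdd _ (by fun_prop))
    filter_upwards [hgγ] with z hz
    simp [← hz]

lemma nestedDist2_twoPoint_le {p : ℝ} (hp : 1 ≤ p) {a b : ℝ} (ha : 0 < a) (hb : 0 < b) :
    nestedDist2 p (fun x y => |x - y|) (twoPoint (a, 1) (-a, -1)) (twoPoint (b, 1) (-b, -1)) ≤
      ENNReal.ofReal |a - b| := by
  have hp0 : 0 < p := by linarith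
  let γ : Measure ((ℝ × ℝ) × (ℝ × ℝ)) := twoPoint ((a, 1), (b, 1)) ((-a, -1), (-b, -1))
  have hγ : γ ∈ coupling (twoPoint (a, 1) (-a, -1)) (twoPoint (b, 1) (-b, -1)) :=
    ⟨map_twoPoint measurable_fst _ _, map_twoPoint measurable_snd _ _⟩
  have hbc : Bicausal2 γ := by
    refine bicausal2_of_ae_eq (f := fun x => b / a * x) (g := fun y => a / b * y)
      (by fun_prop) (by fun_prop) (ae_twoPoint_iff.2 ⟨?_, ?_⟩) (ae_twoPoint_iff.2 ⟨?_, ?_⟩) <;>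
    simp [ha.ne', hb.ne']
  have hcost : ∫⁻ z, cost2 p (fun x y => |x - y|) z ∂γ = ENNReal.ofReal |a - b| ^ p := by
    have hsymm : |-a + b| = |a - b| := by rw [← abs_neg]; congr 1; ring
    rw [lintegral_twoPoint]
    simp only [cost2, sub_self, abs_zero, Real.zero_rpow hp0.ne', add_zero, sub_neg_eq_add,
      hsymm]
    rw [← two_mul, ← mul_assoc, ENNReal.inv_mul_cancel (by simp) (by simp), one_mul,
      ENNReal.ofReal_rpow_of_nonneg (abs_nonneg _) hp0.le]
  calc nestedDist2 p (fun x y => |x - y|) _ _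
      ≤ (∫⁻ z, cost2 p (fun x y => |x - y|) z ∂γ) ^ (1 / p) :=
        ENNReal.rpow_le_rpow (iInf_le_of_le ⟨γ, hγ, hbc⟩ le_rfl) (by positivity)
    _ = ENNReal.ofReal |a - b| := by
        rw [hcost, ← ENNReal.rpow_mul, mul_one_div_cancel hp0.ne', ENNReal.rpow_one]

/-- If `Y₁` is deterministic, then `X₁` and `Y₂` are independent under a bicausal coupling. -/
lemma Bicausal2.measure_inter_eq_mul {γ : Measure ((ℝ × ℝ) × (ℝ × ℝ))} [IsProbabilityMeasure γ]
    (hγ : Bicausal2 γ) {c : ℝ} (hc : ∀ᵐ z ∂γ, z.2.1 = c) {B S : Set ℝ}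
    (hB : MeasurableSet B) (hS : MeasurableSet S) :
    γ.real {z | z.1.1 ∈ B ∧ z.2.2 ∈ S} = γ.real {z | z.1.1 ∈ B} * γ.real {z | z.2.2 ∈ S} := by
  let f : (ℝ × ℝ) × (ℝ × ℝ) → ℝ := fun z => B.indicator (fun _ => (1 : ℝ)) z.1.1
  have hX : MeasurableSet {z : (ℝ × ℝ) × (ℝ × ℝ) | z.1.1 ∈ B} :=
    (measurable_fst.comp measurable_fst) hB
  have hY : MeasurableSet {z : (ℝ × ℝ) × (ℝ × ℝ) | z.2.2 ∈ S} :=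
    (measurable_snd.comp measurable_snd) hS
  have hf_eq : f = Set.indicator {z | z.1.1 ∈ B} 1 := rfl
  have hf : Integrable f γ := hf_eq ▸ (integrable_const 1).indicator hX
  have hY₁ : Measurable fun z : (ℝ × ℝ) × (ℝ × ℝ) => z.2.1 := by fun_prop
  obtain ⟨g, -, hg⟩ := (stronglyMeasurable_condExp (f := f) (μ := γ)
    (m := MeasurableSpace.comap (fun z : (ℝ × ℝ) × (ℝ × ℝ) => z.2.1)
      inferInstance)).measurable.exists_eq_measurable_comp
  have hcond : γ[f | MeasurableSpace.comap Prod.snd inferInstance] =ᵐ[γ] fun _ => g c := by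
    filter_upwards [(hγ B hB).2, hc] with z hz hzc
    rw [hz, hg, Function.comp_apply, hzc]
  have hset : ∀ T : Set (ℝ × ℝ), MeasurableSet T →
      γ.real ({z | z.1.1 ∈ B} ∩ Prod.snd ⁻¹' T) = γ.real (Prod.snd ⁻¹' T) * g c := by
    intro T hT
    have h := setIntegral_condExp (measurable_snd.comap_le) hf ⟨T, hT, rfl⟩
    rw [setIntegral_congr_ae (measurable_snd hT) (hcond.mono fun z hz _ => hz),
      setIntegral_const, hf_eq, integral_indicator_one hX, smul_eq_mul,
      measureReal_restrict_apply hX] at h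
    exact h.symm
  have huniv : γ.real {z | z.1.1 ∈ B} = g c := by simpa using hset Set.univ .univ
  have hmain := hset (Prod.snd ⁻¹' S) (measurable_snd hS)
  rw [huniv, mul_comm]
  exact hmain

/-- Bicausal transport of the two-point measure to a law with deterministic first coordinate is
expensive. -/
lemma half_le_lintegral_cost2 {p : ℝ} (hp : 1 ≤ p) {a c : ℝ} (ha : 0 < a) {ν : Measure (ℝ × ℝ)}
    (hν : ∀ᵐ y ∂ν, y.1 = c) {γ : Measure ((ℝ × ℝ) × (ℝ × ℝ))}
    (hγ : γ ∈ coupling (twoPoint (a, 1) (-a, -1)) ν) (hbc : Bicausal2 γ) :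
    ENNReal.ofReal (1 / 2) ≤ ∫⁻ z, cost2 p (fun x y => |x - y|) z ∂γ := by
  have hγ₁ : IsProbabilityMeasure (γ.map Prod.fst) := hγ.1 ▸ inferInstance
  have : IsProbabilityMeasure γ := Measure.isProbabilityMeasure_of_map Prod.fst
  have hY : ∀ᵐ z ∂γ, z.2.1 = c := ae_of_ae_map measurable_snd.aemeasurable (hγ.2 ▸ hν)
  have hX : ∀ᵐ z ∂γ, z.1 = (a, 1) ∨ z.1 = (-a, -1) := by
    refine ae_of_ae_map (p := fun x => x = (a, 1) ∨ x = (-a, -1)) measurable_fst.aemeasurable ?_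
    rw [hγ.1]
    exact ae_twoPoint_iff.2 ⟨.inl rfl, .inr rfl⟩
  have hmeas : ∀ B S : Set ℝ, MeasurableSet B → MeasurableSet S →
      MeasurableSet {z : (ℝ × ℝ) × (ℝ × ℝ) | z.1.1 ∈ B ∧ z.2.2 ∈ S} := fun B S hB hS =>
    ((measurable_fst.comp measurable_fst) hB).inter ((measurable_snd.comp measurable_snd) hS)
  have hmarg : ∀ B : Set ℝ, MeasurableSet B →
      γ.real {z | z.1.1 ∈ B} = (twoPoint (a, (1 : ℝ)) (-a, -1)).real (Prod.fst ⁻¹' B) := by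
    intro B hB
    rw [← hγ.1, map_measureReal_apply measurable_fst (measurable_fst hB)]
    rfl
  have hpos : γ.real {z | z.1.1 ∈ Set.Ioi 0} = 1 / 2 := by
    rw [hmarg _ measurableSet_Ioi]
    simp [twoPoint, measureReal_def, ha, ha.not_gt, Set.indicator]
  have hneg : γ.real {z | z.1.1 ∈ Set.Iic 0} = 1 / 2 := by
    rw [hmarg _ measurableSet_Iic]
    simp [twoPoint, measureReal_def, ha.le, ha.not_ge, Set.indicator]
  have hsum : γ.real {z | z.2.2 ∈ Set.Iic 0} + γ.real {z | z.2.2 ∈ Set.Ioi 0} = 1 := by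
    have h := probReal_add_probReal_compl (μ := γ)
      (s := {z | z.2.2 ∈ Set.Iic (0 : ℝ)}) ((measurable_snd.comp measurable_snd) measurableSet_Iic)
    rwa [← Set.compl_Iic]
  let s : Set ((ℝ × ℝ) × (ℝ × ℝ)) := {z | z.1.1 ∈ Set.Ioi 0 ∧ z.2.2 ∈ Set.Iic 0}
  let t : Set ((ℝ × ℝ) × (ℝ × ℝ)) := {z | z.1.1 ∈ Set.Iic 0 ∧ z.2.2 ∈ Set.Ioi 0}
  have hsm : MeasurableSet s := hmeas _ _ measurableSet_Ioi measurableSet_Iic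
  have htm : MeasurableSet t := hmeas _ _ measurableSet_Iic measurableSet_Ioi
  have hst : γ.real (s ∪ t) = 1 / 2 := by
    rw [measureReal_union (Set.disjoint_left.2 fun z hz hz' =>
        not_lt.2 (Set.mem_Iic.1 hz'.1) (Set.mem_Ioi.1 hz.1)) htm,
      hbc.measure_inter_eq_mul hY measurableSet_Ioi measurableSet_Iic,
      hbc.measure_inter_eq_mul hY measurableSet_Iic measurableSet_Ioi, hpos, hneg, ← mul_add,
      hsum, mul_one]
  calc ENNReal.ofReal (1 / 2) = ∫⁻ z, (s ∪ t).indicator 1 z ∂γ := by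
        rw [lintegral_indicator_one (hsm.union htm), ← hst, ofReal_measureReal]
    _ ≤ ∫⁻ z, cost2 p (fun x y => |x - y|) z ∂γ := by
        refine lintegral_mono_ae ?_
        filter_upwards [hX] with z hz
        by_cases hzst : z ∈ s ∪ t
        · rw [Set.indicator_of_mem hzst, Pi.one_apply, ← ENNReal.ofReal_one]
          refine ENNReal.ofReal_le_ofReal ?_
          have hone : 1 ≤ |z.1.2 - z.2.2| := by
            rcases hzst with ⟨h₁, h₂⟩ | ⟨h₁, h₂⟩ <;> rcases hz with hz | hz <;>
              simp only [hz, Set.mem_Ioi, Set.mem_Iic] at h₁ h₂ ⊢ <;>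
              first
                | linarith
                | exact le_abs.2 (.inl (by linarith))
                | exact le_abs.2 (.inr (by linarith))
          have h₁ := Real.one_le_rpow hone (by linarith : (0 : ℝ) ≤ p)
          have h₂ := Real.rpow_nonneg (abs_nonneg (z.1.1 - z.2.1)) p
          linarith
        · simp [Set.indicator_of_notMem hzst]

/-- Markov-type bound: any coupling must pay for the mass that `ν` puts away from `Y₁ = 0`. -/
lemma mul_measure_le_lintegral_cost2 {p : ℝ} (hp : 1 ≤ p) {a δ : ℝ} (ha : |a| ≤ δ)
    {ν : Measure (ℝ × ℝ)} {γ : Measure ((ℝ × ℝ) × (ℝ × ℝ))}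
    (hγ : γ ∈ coupling (twoPoint (a, 1) (-a, -1)) ν) :
    ENNReal.ofReal (δ ^ p) * ν {y | 2 * δ ≤ |y.1|} ≤
      ∫⁻ z, cost2 p (fun x y => |x - y|) z ∂γ := by
  have hX : ∀ᵐ z ∂γ, |z.1.1| ≤ δ := by
    refine ae_of_ae_map (p := fun x : ℝ × ℝ => |x.1| ≤ δ) measurable_fst.aemeasurable ?_
    rw [hγ.1]
    exact ae_twoPoint_iff.2 ⟨ha, by simpa using ha⟩
  have hms : MeasurableSet {y : ℝ × ℝ | 2 * δ ≤ |y.1|} :=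
    measurableSet_le measurable_const (by fun_prop)
  calc ENNReal.ofReal (δ ^ p) * ν {y | 2 * δ ≤ |y.1|}
      = ENNReal.ofReal (δ ^ p) * γ {z | 2 * δ ≤ |z.2.1|} := by
        rw [← hγ.2, Measure.map_apply measurable_snd hms]
        rfl
    _ ≤ ENNReal.ofReal (δ ^ p) *
          γ {z | ENNReal.ofReal (δ ^ p) ≤ cost2 p (fun x y => |x - y|) z} := by
        refine mul_le_mul' le_rfl (measure_mono_ae ?_)
        filter_upwards [hX] with z hz hzY
        have hzY' : 2 * δ ≤ |z.2.1| := hzY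
        have hδ : δ ≤ |z.1.1 - z.2.1| := by
          have := abs_sub_abs_le_abs_sub z.2.1 z.1.1
          rw [abs_sub_comm] at this
          linarith
        refine ENNReal.ofReal_le_ofReal ?_
        have h₁ := Real.rpow_le_rpow ((abs_nonneg _).trans ha) hδ (by linarith : (0 : ℝ) ≤ p)
        have h₂ := Real.rpow_nonneg (abs_nonneg (z.1.2 - z.2.2)) p
        linarith
    _ ≤ _ := mul_meas_ge_le_lintegral (measurable_cost2 p) _

/-- A constant lower bound on all bicausal transport costs to a nested-distance limit vanishes. -/
lemma eq_zero_of_tendsto_nestedDist2 {p : ℝ} (hp : 1 ≤ p) {dund : ℝ → ℝ → ℝ}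
    {μ : ℕ → Measure (ℝ × ℝ)} {ν : Measure (ℝ × ℝ)}
    (h : Tendsto (fun n => nestedDist2 p dund (μ n) ν) atTop (nhds 0)) {c : ℝ≥0∞}
    (hc : ∀ᶠ n in atTop, ∀ γ ∈ coupling (μ n) ν, Bicausal2 γ → c ≤ ∫⁻ z, cost2 p dund z ∂γ) :
    c = 0 := by
  have hp0 : 0 < p := by linarith
  have hle : ∀ᶠ n in atTop, c ^ (1 / p) ≤ nestedDist2 p dund (μ n) ν :=
    hc.mono fun n hn =>
      ENNReal.rpow_le_rpow (le_iInf fun γ => hn γ.1 γ.2.1 γ.2.2) (by positivity)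
  have h0 : c ^ (1 / p) = 0 := le_antisymm (ge_of_tendsto h hle) zero_le
  exact (ENNReal.rpow_eq_zero_iff_of_pos (by positivity)).1 h0

lemma not_tendsto_nestedDist2_twoPoint {p : ℝ} (hp : 1 ≤ p) {a : ℕ → ℝ}
    (ha_pos : ∀ᶠ n in atTop, 0 < a n) (ha : Tendsto a atTop (nhds 0)) (ν : Measure (ℝ × ℝ)) :
    ¬ Tendsto (fun n => nestedDist2 p (fun x y => |x - y|) (twoPoint (a n, 1) (-a n, -1)) ν)
      atTop (nhds 0) := by
  intro h
  have hδ : ∀ δ : ℝ, 0 < δ → ν {y | 2 * δ ≤ |y.1|} = 0 := by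
    intro δ hδ
    have hsmall : ∀ᶠ n in atTop, |a n| ≤ δ := by
      have := ha.abs
      rw [abs_zero] at this
      exact this.eventually_le_const hδ
    have h0 := eq_zero_of_tendsto_nestedDist2 hp h
      (hsmall.mono fun n hn γ hγ _ => mul_measure_le_lintegral_cost2 hp hn hγ)
    exact (mul_eq_zero.1 h0).resolve_left
      (ENNReal.ofReal_pos.2 (Real.rpow_pos_of_pos hδ p)).ne'
  have hν : ∀ᵐ y ∂ν, y.1 = 0 := by
    have hall : ∀ᵐ y ∂ν, ∀ k : ℕ, ¬ 2 * (1 / ((k : ℝ) + 1)) ≤ |y.1| :=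
      ae_all_iff.2 fun k => measure_eq_zero_iff_ae_notMem.1 (hδ _ (by positivity))
    filter_upwards [hall] with y hy
    by_contra hne
    obtain ⟨k, hk⟩ := exists_nat_one_div_lt (half_pos (abs_pos.2 hne))
    exact hy k (by linarith)
  have h0 := eq_zero_of_tendsto_nestedDist2 hp h
    (ha_pos.mono fun n hn γ hγ hbc => half_le_lintegral_cost2 hp hn hν hγ hbc)
  norm_num at h0

/-- with `d̲` the usual distance and `μ_n = (δ_{(1/n,1)} + δ_{(-1/n,-1)})/2`,
the sequence `(μ_n)` satisfies `d_p^nd(μ_n,μ_m) ≤ |1/n - 1/m|`, hence is Cauchy for the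
nested distance, but it has no limit in `𝒫^p(ℝ²)`: `(𝒫^p(ℝ²), d_p^nd)` is not complete. -/
theorem nestedDist_not_complete (p : ℝ) (hp : 1 ≤ p) :
    ∀ dund : ℝ → ℝ → ℝ, dund = (fun x y => |x - y|) →
    ∀ μ : ℕ → Measure (ℝ × ℝ),
      μ = (fun n : ℕ => (2⁻¹ : ℝ≥0∞) •
        (Measure.dirac ((1 / (n : ℝ), 1) : ℝ × ℝ) +
         Measure.dirac ((-(1 / (n : ℝ)), -1) : ℝ × ℝ))) →
    (∀ n, 1 ≤ n → MemP2 p dund (μ n)) ∧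
    (∀ n m : ℕ, 1 ≤ n → 1 ≤ m →
      nestedDist2 p dund (μ n) (μ m) ≤ ENNReal.ofReal |1 / (n : ℝ) - 1 / (m : ℝ)|) ∧
    (∀ ε : ℝ≥0∞, 0 < ε → ∃ M : ℕ, ∀ n m : ℕ, M ≤ n → M ≤ m →
      nestedDist2 p dund (μ n) (μ m) < ε) ∧
    ¬ ∃ ν : Measure (ℝ × ℝ), MemP2 p dund ν ∧
        Tendsto (fun n => nestedDist2 p dund (μ n) ν) atTop (nhds 0) := by
  rintro _ rfl _ rfl
  have hlim : Tendsto (fun n : ℕ => 1 / (n : ℝ)) atTop (nhds 0) :=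
    tendsto_one_div_atTop_nhds_zero_nat
  have hpos : ∀ n : ℕ, 1 ≤ n → 0 < 1 / (n : ℝ) := fun n hn =>
    one_div_pos.2 (Nat.cast_pos.2 hn)
  have hle : ∀ n m : ℕ, 1 ≤ n → 1 ≤ m →
      nestedDist2 p (fun x y => |x - y|) (twoPoint (1 / (n : ℝ), 1) (-(1 / (n : ℝ)), -1))
        (twoPoint (1 / (m : ℝ), 1) (-(1 / (m : ℝ)), -1)) ≤
      ENNReal.ofReal |1 / (n : ℝ) - 1 / (m : ℝ)| := fun n m hn hm =>
    nestedDist2_twoPoint_le hp (hpos n hn) (hpos m hm)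
  refine ⟨fun n _ => memP2_twoPoint p _ _ _, hle, fun ε hε => ?_, ?_⟩
  · obtain ⟨M, hM⟩ := EMetric.cauchySeq_iff.1 hlim.cauchySeq ε hε
    refine ⟨max M 1, fun n m hn hm => (hle n m (le_of_max_le_right hn)
      (le_of_max_le_right hm)).trans_lt ?_⟩
    simpa [edist_dist, Real.dist_eq] using hM n (le_of_max_le_left hn) m (le_of_max_le_left hm)
  · rintro ⟨ν, -, hν⟩
    exact not_tendsto_nestedDist2_twoPoint hp ((eventually_ge_atTop 1).mono hpos) hlim ν hν
end
end

section
/- For all μ, ν ∈ 𝒫^p(ℝ²), d_p^nd(μ,ν)^p = inf_{γ̄ ∈ Π(μ₁,ν₁)} ∫ [ d̲(x,y)^p + W_p(μ^x, ν^y)^p ] γ̄(dx,dy), where μ₁, ν₁ are the first-coordinate marginals of μ, ν, and x ↦ μ^x, y ↦ ν^y are the regular conditional distributions of the second coordinate given the first. -/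
open MeasureTheory ProbabilityTheory Filter
open scoped ENNReal NNReal Topology

noncomputable section

section Quantile

open unitInterval

/-- The quantile function of `m` on the open unit interval, extended by `0` to the endpoints. -/
def unitQuantile (m : Measure ℝ) (u : I) : ℝ :=
  if u ∈ Set.Ioo 0 1 then sInf {y : ℝ | (u : ℝ) ≤ cdf m y} else 0

lemma unitQuantile_le_iff (m : Measure ℝ) {u : I} (hu : u ∈ Set.Ioo 0 1) (y : ℝ) :
    unitQuantile m u ≤ y ↔ (u : ℝ) ≤ cdf m y := by
  rw [unitQuantile, if_pos hu]
  have h0 : (0 : ℝ) < u := hu.1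
  have h1 : (u : ℝ) < 1 := hu.2
  have hbdd : BddBelow {y : ℝ | (u : ℝ) ≤ cdf m y} := by
    obtain ⟨a, ha⟩ := ((tendsto_cdf_atBot m).eventually (gt_mem_nhds h0)).exists
    refine ⟨a, fun y hy => ?_⟩
    by_contra! h
    exact absurd (hy.trans (monotone_cdf m h.le)) (not_le.mpr ha)
  have hne : {y : ℝ | (u : ℝ) ≤ cdf m y}.Nonempty := by
    obtain ⟨a, ha⟩ := ((tendsto_cdf_atTop m).eventually (lt_mem_nhds h1)).exists
    exact ⟨a, ha.le⟩
  refine ⟨fun h => ?_, fun h => csInf_le hbdd h⟩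
  have hc : Tendsto (cdf m) (𝓝[>] y) (𝓝 (cdf m y)) :=
    continuousWithinAt_Ioi_iff_Ici.mpr ((cdf m).right_continuous y)
  refine ge_of_tendsto hc (eventually_nhdsWithin_of_forall fun z hz => ?_)
  obtain ⟨w, hw, hwz⟩ := exists_lt_of_csInf_lt hne (lt_of_le_of_lt h hz)
  exact le_trans hw (monotone_cdf m hwz.le)

lemma ae_mem_Ioo_unitInterval : ∀ᵐ u : I, u ∈ Set.Ioo (0 : I) 1 := by
  have h : ∀ᵐ u : I, u ∉ ({0, 1} : Set I) :=
    measure_eq_zero_iff_ae_notMem.mp ((Set.toFinite _).measure_zero _)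
  filter_upwards [h] with u hu
  simp only [Set.mem_insert_iff, Set.mem_singleton_iff, not_or] at hu
  exact ⟨lt_of_le_of_ne u.2.1 (Ne.symm hu.1), lt_of_le_of_ne u.2.2 hu.2⟩

lemma monotoneOn_unitQuantile (m : Measure ℝ) :
    MonotoneOn (unitQuantile m) (Set.Ioo 0 1) := by
  intro u hu v hv huv
  rw [unitQuantile_le_iff m hu]
  exact le_trans (show (u : ℝ) ≤ v from huv) ((unitQuantile_le_iff m hv _).mp le_rfl)

lemma ae_continuousAt_unitQuantile (m : Measure ℝ) :
    ∀ᵐ u : I, ContinuousAt (unitQuantile m) u := by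
  have h := measure_eq_zero_iff_ae_notMem.mp
    ((monotoneOn_unitQuantile m).countable_not_continuousWithinAt.measure_zero volume)
  filter_upwards [h, ae_mem_Ioo_unitInterval] with u hu hu'
  have : ContinuousWithinAt (unitQuantile m) (Set.Ioo 0 1) u := by
    by_contra hc
    exact hu ⟨hu', hc⟩
  exact this.continuousAt (isOpen_Ioo.mem_nhds hu')

lemma measurable_unitQuantile_kernel {α : Type*} [MeasurableSpace α] (κ : Kernel α ℝ)
    [IsMarkovKernel κ] : Measurable fun z : α × I => unitQuantile (κ z.1) z.2 := by
  refine measurable_of_Iic fun y => ?_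
  have hset : (fun z : α × I => unitQuantile (κ z.1) z.2) ⁻¹' Set.Iic y =
      ({z | z.2 ∈ Set.Ioo 0 1} ∩ {z | (z.2 : ℝ) ≤ (κ z.1).real (Set.Iic y)}) ∪
      ({z | z.2 ∈ Set.Ioo 0 1}ᶜ ∩ {_z | (0 : ℝ) ≤ y}) := by
    ext z
    by_cases hz : z.2 ∈ Set.Ioo (0 : I) 1
    · simp only [Set.mem_preimage, Set.mem_Iic, unitQuantile_le_iff _ hz,
        ProbabilityTheory.cdf_eq_real]
      simp [Set.mem_Ioo.mp hz]
    · have hz0 : unitQuantile (κ z.1) z.2 = 0 := if_neg hz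
      simp only [Set.mem_preimage, Set.mem_Iic, hz0]
      exact ⟨fun h => Or.inr ⟨hz, h⟩, fun h => h.elim (fun h => absurd h.1 hz) fun h => h.2⟩
  rw [hset]
  have hI : MeasurableSet {z : α × I | z.2 ∈ Set.Ioo (0 : I) 1} :=
    measurable_snd measurableSet_Ioo
  refine (hI.inter (measurableSet_le (measurable_subtype_coe.comp measurable_snd) ?_)).union
    (hI.compl.inter (.const _))
  exact ((κ.measurable_coe measurableSet_Iic).comp measurable_fst).ennreal_toReal

lemma measurable_unitQuantile (m : Measure ℝ) [IsProbabilityMeasure m] :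
    Measurable (unitQuantile m) :=
  (measurable_unitQuantile_kernel (Kernel.const Unit m)).comp
    (measurable_prodMk_left (x := ()))

lemma map_unitQuantile (m : Measure ℝ) [IsProbabilityMeasure m] :
    (volume : Measure I).map (unitQuantile m) = m := by
  have := Measure.isProbabilityMeasure_map (μ := (volume : Measure I))
    (measurable_unitQuantile m).aemeasurable
  refine Measure.ext_of_Iic _ _ fun y => ?_
  rw [Measure.map_apply (measurable_unitQuantile m) measurableSet_Iic, ← ofReal_cdf]
  have hI : cdf m y ∈ I := ⟨cdf_nonneg m y, cdf_le_one m y⟩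
  have h := unitInterval.volume_Iic ⟨_, hI⟩
  rw [← h]
  refine measure_congr ?_
  filter_upwards [ae_mem_Ioo_unitInterval] with u hu
  exact propext (unitQuantile_le_iff m hu y)

end Quantile

section Copula

/-- Every coupling of two image measures lifts to a coupling of the original measures. -/
lemma exists_coupling_map_eq {α β : Type*} [MeasurableSpace α] [MeasurableSpace β]
    [StandardBorelSpace α] [StandardBorelSpace β] [Nonempty α] [Nonempty β]
    {A : Measure α} {B : Measure β} [IsProbabilityMeasure A] [IsProbabilityMeasure B]
    {f : α → ℝ} {g : β → ℝ} (hf : Measurable f) (hg : Measurable g)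
    {η : Measure (ℝ × ℝ)} (hη : η ∈ coupling (A.map f) (B.map g)) :
    ∃ C ∈ coupling A B, C.map (Prod.map f g) = η := by
  obtain ⟨h1, h2⟩ := hη
  have : IsProbabilityMeasure η := by
    have := Measure.isProbabilityMeasure_map (μ := A) hf.aemeasurable
    rw [← h1] at this
    exact Measure.isProbabilityMeasure_of_map Prod.fst
  let K := condDistrib id f A
  let L := condDistrib id g B
  have hK : ∀ᵐ z ∂η, (K z.1).map f = Measure.dirac z.1 := by
    have h : K.map f =ᵐ[A.map f] Kernel.id :=
      (condDistrib_comp f (by fun_prop) hf).symm.trans (condDistrib_self f)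
    rw [← h1] at h
    filter_upwards [ae_of_ae_map (by fun_prop) h] with z hz
    rw [Kernel.map_apply _ hf] at hz
    exact hz
  have hL : ∀ᵐ z ∂η, (L z.2).map g = Measure.dirac z.2 := by
    have h : L.map g =ᵐ[B.map g] Kernel.id :=
      (condDistrib_comp g (by fun_prop) hg).symm.trans (condDistrib_self g)
    rw [← h2] at h
    filter_upwards [ae_of_ae_map (by fun_prop) h] with z hz
    rw [Kernel.map_apply _ hg] at hz
    exact hz
  have happ : ∀ s t, MeasurableSet s → MeasurableSet t →
      (η.bind (K ∥ₖ L)) (s ×ˢ t) = ∫⁻ z, K z.1 s * L z.2 t ∂η := fun s t hs ht => by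
    rw [Measure.bind_apply (hs.prod ht) (Kernel.aemeasurable _)]
    simp_rw [Kernel.parallelComp_apply_prod]
  refine ⟨η.bind (K ∥ₖ L), ⟨?_, ?_⟩, ?_⟩
  · have hAK : A = (A.map f).bind K := by
      simpa using (condDistrib_comp_map (μ := A) (X := f) (Y := id) (by fun_prop)
        (by fun_prop)).symm
    ext s hs
    rw [Measure.map_apply measurable_fst hs, ← Set.prod_univ, happ s _ hs .univ]
    simp only [measure_univ, mul_one]
    conv_rhs => rw [hAK, Measure.bind_apply hs (Kernel.aemeasurable _), ← h1,
      lintegral_map (K.measurable_coe hs) measurable_fst]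
  · have hBL : B = (B.map g).bind L := by
      simpa using (condDistrib_comp_map (μ := B) (X := g) (Y := id) (by fun_prop)
        (by fun_prop)).symm
    ext s hs
    rw [Measure.map_apply measurable_snd hs, ← Set.univ_prod, happ _ s .univ hs]
    simp only [measure_univ, one_mul]
    conv_rhs => rw [hBL, Measure.bind_apply hs (Kernel.aemeasurable _), ← h2,
      lintegral_map (L.measurable_coe hs) measurable_snd]
  · refine Measure.ext_prod fun {s t} hs ht => ?_
    rw [Measure.map_apply (hf.prodMap hg) (hs.prod ht), Set.preimage_prod_map_prod,
      happ _ _ (hf hs) (hg ht), ← lintegral_indicator_one (hs.prod ht)]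
    refine lintegral_congr_ae ?_
    filter_upwards [hK, hL] with z hz hz'
    rw [← Measure.map_apply hf hs, ← Measure.map_apply hg ht, hz, hz',
      Measure.dirac_apply' _ hs, Measure.dirac_apply' _ ht]
    by_cases h : z.1 ∈ s <;> by_cases h' : z.2 ∈ t <;> simp [h, h']

end Copula

section Semicontinuity

lemma exists_dense_couplings {α β : Type*} [TopologicalSpace α] [TopologicalSpace β]
    [CompactSpace α] [CompactSpace β] [TopologicalSpace.MetrizableSpace α]
    [TopologicalSpace.MetrizableSpace β]
    [SecondCountableTopology α] [SecondCountableTopology β]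
    [MeasurableSpace α] [MeasurableSpace β] [BorelSpace α] [BorelSpace β]
    (A : Measure α) (B : Measure β) [IsProbabilityMeasure A] [IsProbabilityMeasure B] :
    ∃ C : ℕ → ProbabilityMeasure (α × β), (∀ n, (C n : Measure (α × β)) ∈ coupling A B) ∧
      ∀ D : ProbabilityMeasure (α × β), (D : Measure (α × β)) ∈ coupling A B →
        ∃ k : ℕ → ℕ, Tendsto (fun n => C (k n)) atTop (𝓝 D) := by
  let S : Set (ProbabilityMeasure (α × β)) := {D | (D : Measure (α × β)) ∈ coupling A B}
  let := TopologicalSpace.metrizableSpaceMetric (ProbabilityMeasure (α × β))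
  have hne : Nonempty S :=
    ⟨⟨⟨A.prod B, inferInstance⟩, show A.prod B ∈ coupling A B by
      constructor <;> simp [Measure.map_fst_prod, Measure.map_snd_prod]⟩⟩
  obtain ⟨u, hu⟩ := TopologicalSpace.exists_dense_seq S
  refine ⟨fun n => (u n).1, fun n => (u n).2, fun D hD => ?_⟩
  obtain ⟨x, hx, hlim⟩ := mem_closure_iff_seq_limit.mp (hu ⟨D, hD⟩)
  choose k hk using hx
  refine ⟨k, ?_⟩
  have := (continuous_subtype_val.tendsto _).comp hlim
  refine this.congr fun n => ?_
  simp [← hk n]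

lemma le_liminf_map_isOpen {α β : Type*} [TopologicalSpace α] [MeasurableSpace α]
    [OpensMeasurableSpace α] [HasOuterApproxClosed α] [TopologicalSpace β] [MeasurableSpace β]
    [OpensMeasurableSpace β] {D : ProbabilityMeasure α} {C : ℕ → ProbabilityMeasure α}
    (hC : Tendsto C atTop (𝓝 D)) {f : α → β} (hf : Measurable f)
    (hfc : ∀ᵐ z ∂(D : Measure α), ContinuousAt f z) {G : Set β} (hG : IsOpen G) :
    (D : Measure α).map f G ≤ liminf (fun n => (C n : Measure α).map f G) atTop := by
  simp_rw [Measure.map_apply hf hG.measurableSet]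
  calc (D : Measure α) (f ⁻¹' G) ≤ (D : Measure α) (interior (f ⁻¹' G)) := by
        refine measure_mono_ae ?_
        filter_upwards [hfc] with z hz hzG
        exact mem_interior_iff_mem_nhds.mpr (hz (hG.mem_nhds hzG))
    _ ≤ liminf (fun n => (C n : Measure α) (interior (f ⁻¹' G))) atTop :=
        ProbabilityMeasure.le_liminf_measure_open_of_tendsto hC isOpen_interior
    _ ≤ _ := liminf_le_liminf (Eventually.of_forall fun n => measure_mono interior_subset)

lemma lintegral_add_coupling {η : Measure (ℝ × ℝ)} {m m' : Measure ℝ} (hη : η ∈ coupling m m')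
    {a b : ℝ → ℝ≥0∞} (ha : Measurable a) (hb : Measurable b) :
    ∫⁻ z, (a z.1 + b z.2) ∂η = ∫⁻ x, a x ∂m + ∫⁻ y, b y ∂m' := by
  rw [lintegral_add_left (by fun_prop), ← hη.1, ← hη.2, lintegral_map ha measurable_fst,
    lintegral_map hb measurable_snd]

/-- Upper semicontinuity of the transport cost along couplings with fixed marginals. -/
lemma iInf_lintegral_le_of_liminf {m m' : Measure ℝ} {η : Measure (ℝ × ℝ)}
    {ηs : ℕ → Measure (ℝ × ℝ)} (hη : η ∈ coupling m m') (hηs : ∀ n, ηs n ∈ coupling m m')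
    (hopen : ∀ G, IsOpen G → η G ≤ liminf (fun n => ηs n G) atTop)
    {c : ℝ × ℝ → ℝ} {a b : ℝ → ℝ} (hc : Continuous c) (ha : Continuous a) (hb : Continuous b)
    (hc0 : ∀ z, 0 ≤ c z) (ha0 : ∀ x, 0 ≤ a x) (hb0 : ∀ x, 0 ≤ b x)
    (hcab : ∀ z, c z ≤ a z.1 + b z.2)
    (ham : ∫⁻ x, ENNReal.ofReal (a x) ∂m ≠ ∞) (hbm : ∫⁻ x, ENNReal.ofReal (b x) ∂m' ≠ ∞) :
    ⨅ n, ∫⁻ z, ENNReal.ofReal (c z) ∂(ηs n) ≤ ∫⁻ z, ENNReal.ofReal (c z) ∂η := by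
  set A := ∫⁻ x, ENNReal.ofReal (a x) ∂m + ∫⁻ x, ENNReal.ofReal (b x) ∂m' with hA
  have hA_top : A ≠ ∞ := ENNReal.add_ne_top.mpr ⟨ham, hbm⟩
  let h : ℝ × ℝ → ℝ := fun z => a z.1 + b z.2 - c z
  have hhc : Continuous h := by fun_prop
  have hh0 : 0 ≤ h := fun z => sub_nonneg.mpr (hcab z)
  have hsum : ∀ θ ∈ coupling m m',
      ∫⁻ z, ENNReal.ofReal (h z) ∂θ + ∫⁻ z, ENNReal.ofReal (c z) ∂θ = A := by
    intro θ hθ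
    rw [← lintegral_add_left hhc.measurable.ennreal_ofReal,
      hA, ← lintegral_add_coupling hθ ha.measurable.ennreal_ofReal hb.measurable.ennreal_ofReal]
    refine lintegral_congr fun z => ?_
    rw [← ENNReal.ofReal_add (hh0 z) (hc0 z), ← ENNReal.ofReal_add (ha0 _) (hb0 _)]
    simp [h]
  set s := ⨅ n, ∫⁻ z, ENNReal.ofReal (c z) ∂(ηs n) with hs
  set t := ∫⁻ z, ENNReal.ofReal (c z) ∂η
  have hsA : s ≤ A := (iInf_le _ 0).trans (by rw [← hsum _ (hηs 0)]; exact le_add_self)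
  have hle : ∫⁻ z, ENNReal.ofReal (h z) ∂η ≤ A - s := by
    refine (lintegral_le_liminf_lintegral_of_forall_isOpen_measure_le_liminf_measure
      hhc hh0 hopen).trans ?_
    refine liminf_le_of_frequently_le' (Frequently.of_forall fun n => ?_)
    refine ENNReal.le_sub_of_add_le_right (ne_top_of_le_ne_top hA_top hsA) ?_
    rw [← hsum _ (hηs n)]
    gcongr
    exact iInf_le _ n
  have h1 : A ≤ A - s + t := by
    rw [← hsum _ hη]
    gcongr
    rwa [hsum _ hη]
  have h2 : A + s ≤ A + t := by
    calc A + s ≤ A - s + t + s := by gcongr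
      _ = (A - s + s) + t := by ring
      _ = A + t := by rw [tsub_add_cancel_of_le hsA]
  exact (ENNReal.add_le_add_iff_left hA_top).mp h2

end Semicontinuity

section Selection

open unitInterval

lemma isProbabilityMeasure_of_mem_coupling_s4 {α β : Type*} [MeasurableSpace α] [MeasurableSpace β]
    {A : Measure α} {B : Measure β} {C : Measure (α × β)} [IsProbabilityMeasure A]
    (hC : C ∈ coupling A B) : IsProbabilityMeasure C := by
  have : IsProbabilityMeasure (C.map Prod.fst) := by
    rw [hC.1]
    infer_instance
  exact Measure.isProbabilityMeasure_of_map Prod.fst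

lemma map_prodMap_mem_coupling {α β α' β' : Type*} [MeasurableSpace α] [MeasurableSpace β]
    [MeasurableSpace α'] [MeasurableSpace β'] {A : Measure α} {B : Measure β} {C : Measure (α × β)}
    (hC : C ∈ coupling A B) {f : α → α'} {g : β → β'} (hf : Measurable f) (hg : Measurable g) :
    C.map (Prod.map f g) ∈ coupling (A.map f) (B.map g) := by
  obtain ⟨rfl, rfl⟩ := hC
  constructor
  · rw [Measure.map_map measurable_fst (by fun_prop), Measure.map_map hf measurable_fst]
    rfl
  · rw [Measure.map_map measurable_snd (by fun_prop), Measure.map_map hg measurable_snd]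
    rfl

lemma ae_continuousAt_prodMap_of_mem_coupling {α β α' β' : Type*} [MeasurableSpace α]
    [MeasurableSpace β] [TopologicalSpace α] [TopologicalSpace β] [TopologicalSpace α']
    [TopologicalSpace β'] {A : Measure α} {B : Measure β} {C : Measure (α × β)}
    (hC : C ∈ coupling A B) {f : α → α'} {g : β → β'} (hf : ∀ᵐ x ∂A, ContinuousAt f x)
    (hg : ∀ᵐ y ∂B, ContinuousAt g y) : ∀ᵐ z ∂C, ContinuousAt (Prod.map f g) z := by
  rw [← hC.1] at hf
  rw [← hC.2] at hg
  filter_upwards [ae_of_ae_map (by fun_prop) hf, ae_of_ae_map (by fun_prop) hg] with z h1 h2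
  exact h1.prodMap h2

/-- A measurable choice of `ε`-optimal couplings between the values of two kernels. -/
lemma exists_kernel_nearly_optimal (κ κ' : Kernel ℝ ℝ) [IsMarkovKernel κ] [IsMarkovKernel κ']
    {c : ℝ × ℝ → ℝ} {a b : ℝ → ℝ} (hc : Continuous c) (ha : Continuous a) (hb : Continuous b)
    (hc0 : ∀ z, 0 ≤ c z) (ha0 : ∀ x, 0 ≤ a x) (hb0 : ∀ x, 0 ≤ b x)
    (hcab : ∀ z, c z ≤ a z.1 + b z.2) {ε : ℝ≥0∞} (hε : ε ≠ 0) :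
    ∃ η : Kernel (ℝ × ℝ) (ℝ × ℝ), IsMarkovKernel η ∧
      (∀ q, η q ∈ coupling (κ q.1) (κ' q.2)) ∧
      ∀ q, ∫⁻ x, ENNReal.ofReal (a x) ∂(κ q.1) ≠ ∞ → ∫⁻ y, ENNReal.ofReal (b y) ∂(κ' q.2) ≠ ∞ →
        ∫⁻ z, ENNReal.ofReal (c z) ∂(η q) ≤
          (⨅ θ : {θ // θ ∈ coupling (κ q.1) (κ' q.2)},
            ∫⁻ z, ENNReal.ofReal (c z) ∂(θ : Measure (ℝ × ℝ))) + ε := by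
  obtain ⟨C, hC, hCdense⟩ := exists_dense_couplings (volume : Measure I) (volume : Measure I)
  let T : (ℝ × ℝ) × (I × I) → ℝ × ℝ := fun w =>
    Prod.map (unitQuantile (κ w.1.1)) (unitQuantile (κ' w.1.2)) w.2
  have hT : Measurable T :=
    ((measurable_unitQuantile_kernel κ).comp (g := fun w : ℝ × I => unitQuantile (κ w.1) w.2)
      (f := fun w : (ℝ × ℝ) × (I × I) => (w.1.1, w.2.1)) (by fun_prop)).prodMk
    ((measurable_unitQuantile_kernel κ').comp (g := fun w : ℝ × I => unitQuantile (κ' w.1) w.2)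
      (f := fun w : (ℝ × ℝ) × (I × I) => (w.1.2, w.2.2)) (by fun_prop))
  have hcm : Measurable fun z => ENNReal.ofReal (c z) := hc.measurable.ennreal_ofReal
  have hmap : ∀ q, ∀ D ∈ coupling (volume : Measure I) (volume : Measure I),
      D.map (fun w => T (q, w)) ∈ coupling (κ q.1) (κ' q.2) := fun q D hD => by
    have h := map_prodMap_mem_coupling hD (measurable_unitQuantile (κ q.1))
      (measurable_unitQuantile (κ' q.2))
    rwa [map_unitQuantile, map_unitQuantile] at h
  let F : ℕ → ℝ × ℝ → ℝ≥0∞ := fun n q => ∫⁻ w, ENNReal.ofReal (c (T (q, w))) ∂(C n : Measure _)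
  have hF : ∀ n, Measurable (F n) := fun n => (hcm.comp hT).lintegral_prod_right'
  have hFs : Measurable fun q => ⨅ n, F n q := Measurable.iInf hF
  have hex : ∀ q, ∃ n, F n q ≤ (⨅ n, F n q) + ε := fun q => by
    by_cases h : ⨅ n, F n q = ∞
    · exact ⟨0, by simp [h]⟩
    · obtain ⟨n, hn⟩ := iInf_lt_iff.mp (ENNReal.lt_add_right h hε)
      exact ⟨n, hn.le⟩
  classical
  let k : ℝ × ℝ → ℕ := fun q => Nat.find (hex q)
  have hk : Measurable k :=
    measurable_find hex fun n => measurableSet_le (hF n) (hFs.add_const ε)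
  let M : Kernel (ℝ × ℝ) (I × I) := (Kernel.ofFunOfCountable fun n => (C n : Measure _)).comap k hk
  have : IsMarkovKernel M := ⟨fun q => inferInstanceAs
    (IsProbabilityMeasure (C (k q) : Measure (I × I)))⟩
  have hη : ∀ q, ((Kernel.id ×ₖ M).map T) q = (C (k q) : Measure _).map fun w => T (q, w) := by
    intro q
    rw [Kernel.map_apply _ hT, Kernel.prod_apply, Kernel.id_apply, Measure.dirac_prod,
      Measure.map_map hT (by fun_prop)]
    rfl
  refine ⟨(Kernel.id ×ₖ M).map T, Kernel.IsMarkovKernel.map _ hT, fun q => ?_, fun q hqa hqb => ?_⟩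
  · rw [hη]
    exact hmap q _ (hC _)
  · rw [hη, lintegral_map hcm (by fun_prop)]
    refine (Nat.find_spec (hex q)).trans ?_
    gcongr
    refine le_iInf fun ⟨θ, hθ⟩ => ?_
    have hθ' := hθ
    rw [← map_unitQuantile (κ q.1), ← map_unitQuantile (κ' q.2)] at hθ'
    obtain ⟨D, hD, rfl⟩ := exists_coupling_map_eq (measurable_unitQuantile (κ q.1))
      (measurable_unitQuantile (κ' q.2)) hθ'
    have hDp : IsProbabilityMeasure D := isProbabilityMeasure_of_mem_coupling_s4 hD
    obtain ⟨l, hl⟩ := hCdense ⟨D, hDp⟩ hD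
    have h := iInf_lintegral_le_of_liminf hθ (fun n => hmap q _ (hC (l n)))
      (fun G hG => le_liminf_map_isOpen hl
        ((measurable_unitQuantile _).prodMap (measurable_unitQuantile _))
        (ae_continuousAt_prodMap_of_mem_coupling hD (ae_continuousAt_unitQuantile _)
          (ae_continuousAt_unitQuantile _)) hG) hc ha hb hc0 ha0 hb0 hcab hqa hqb
    refine le_trans (le_iInf fun n => ?_) h
    rw [lintegral_map hcm (by fun_prop)]
    exact iInf_le _ _

end Selection

section Causality

variable {Ω α β δ : Type*} [MeasurableSpace Ω] [MeasurableSpace α] [MeasurableSpace β]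
  [MeasurableSpace δ] [StandardBorelSpace δ] [Nonempty δ]
  {P : Measure Ω} [IsFiniteMeasure P] {X : Ω → α} {X' : Ω → β} {Y : Ω → δ}

/-- Causality in terms of conditional distributions. -/
lemma forall_condExp_eq_iff_condDistrib (hX : Measurable X) (hX' : Measurable X')
    (hY : Measurable Y) :
    (∀ B, MeasurableSet B →
      P[fun ω => Set.indicator B (fun _ => (1 : ℝ)) (Y ω) |
        MeasurableSpace.comap (fun ω => (X ω, X' ω)) inferInstance] =ᵐ[P]
      P[fun ω => Set.indicator B (fun _ => (1 : ℝ)) (Y ω) |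
        MeasurableSpace.comap X inferInstance]) ↔
    condDistrib Y (fun ω => (X ω, X' ω)) P =ᵐ[P.map fun ω => (X ω, X' ω)]
      (condDistrib Y X P).prodMkRight β := by
  have hXX : Measurable fun ω => (X ω, X' ω) := hX.prodMk hX'
  have key : ∀ B, MeasurableSet B →
      ((fun ω => (condDistrib Y (fun ω => (X ω, X' ω)) P (X ω, X' ω)).real B) =ᵐ[P]
        P[fun ω => Set.indicator B (fun _ => (1 : ℝ)) (Y ω) |
          MeasurableSpace.comap (fun ω => (X ω, X' ω)) inferInstance]) ∧
      ((fun ω => (condDistrib Y X P (X ω)).real B) =ᵐ[P]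
        P[fun ω => Set.indicator B (fun _ => (1 : ℝ)) (Y ω) |
          MeasurableSpace.comap X inferInstance]) := fun B hB =>
    ⟨condDistrib_ae_eq_condExp hXX hY hB, condDistrib_ae_eq_condExp hX hY hB⟩
  constructor
  · intro h
    rw [condDistrib_ae_eq_iff_measure_eq_compProd _ hY.aemeasurable,
      ← compProd_map_condDistrib hY.aemeasurable]
    refine Measure.ext_prod fun {s t} hs ht => ?_
    rw [Measure.compProd_apply_prod hs ht, Measure.compProd_apply_prod hs ht]
    refine lintegral_congr_ae (ae_restrict_of_ae ?_)
    refine (ae_map_iff hXX.aemeasurable (measurableSet_eq_fun (Kernel.measurable_coe _ ht)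
      (Kernel.measurable_coe _ ht))).mpr ?_
    filter_upwards [(key t ht).1.trans ((h t ht).trans (key t ht).2.symm)] with ω hω
    exact (measureReal_eq_measureReal_iff).mp hω
  · intro h B hB
    refine (key B hB).1.symm.trans (EventuallyEq.trans ?_ (key B hB).2)
    filter_upwards [ae_of_ae_map hXX.aemeasurable h] with ω hω
    rw [hω, Kernel.prodMkRight_apply]

/-- `Y` is conditionally independent of `X'` given `X` iff the law of `X'` given `(X, Y)`
only depends on `X`. -/
lemma forall_condExp_eq_iff_map_eq_compProd [StandardBorelSpace Ω] [StandardBorelSpace β]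
    [Nonempty β] (hX : Measurable X) (hX' : Measurable X')
    (hY : Measurable Y) :
    (∀ B, MeasurableSet B →
      P[fun ω => Set.indicator B (fun _ => (1 : ℝ)) (Y ω) |
        MeasurableSpace.comap (fun ω => (X ω, X' ω)) inferInstance] =ᵐ[P]
      P[fun ω => Set.indicator B (fun _ => (1 : ℝ)) (Y ω) |
        MeasurableSpace.comap X inferInstance]) ↔
    P.map (fun ω => ((X ω, Y ω), X' ω)) =
      P.map (fun ω => (X ω, Y ω)) ⊗ₘ (condDistrib X' X P).prodMkRight δ := by
  rw [forall_condExp_eq_iff_condDistrib hX hX' hY,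
    ← condIndepFun_iff_condDistrib_prod_ae_eq_prodMkRight hY hX' hX,
    ← condDistrib_ae_eq_iff_measure_eq_compProd _ hX'.aemeasurable,
    ← condIndepFun_iff_condDistrib_prod_ae_eq_prodMkRight hX' hY hX]
  exact ⟨fun h => h.symm, fun h => h.symm⟩

end Causality

section Bicausal

lemma condK_eq (μ : Measure (ℝ × ℝ)) [h : IsFiniteMeasure μ] : condK μ = μ.condKernel := by
  rw [condK, dif_pos h]

instance (μ : Measure (ℝ × ℝ)) [IsFiniteMeasure μ] : IsMarkovKernel (condK μ) := by
  rw [condK_eq]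
  infer_instance

lemma condDistrib_eq_condK {Ω : Type*} [MeasurableSpace Ω] {P : Measure Ω} [IsFiniteMeasure P]
    {X X' : Ω → ℝ} : condDistrib X' X P = condK (P.map fun ω => (X ω, X' ω)) := by
  rw [condDistrib, condK_eq]

lemma map_compProd_comap {α β δ : Type*} [MeasurableSpace α] [MeasurableSpace β]
    [MeasurableSpace δ] (Q : Measure α) [SFinite Q] (κ : Kernel β δ) [IsSFiniteKernel κ]
    {f : α → β} (hf : Measurable f) :
    (Q ⊗ₘ κ.comap f hf).map (Prod.map f id) = Q.map f ⊗ₘ κ := by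
  refine Measure.ext_of_lintegral _ fun u hu => ?_
  rw [lintegral_map hu (by fun_prop), Measure.lintegral_compProd (by fun_prop),
    Measure.lintegral_compProd hu, lintegral_map (by fun_prop) hf]
  rfl

lemma bicausal2_iff (γ : Measure ((ℝ × ℝ) × (ℝ × ℝ))) [IsFiniteMeasure γ] :
    Bicausal2 γ ↔
      γ.map (fun z => ((z.1.1, z.2.1), z.1.2)) =
        γ.map (fun z => (z.1.1, z.2.1)) ⊗ₘ (condK (γ.map Prod.fst)).prodMkRight ℝ ∧
      γ.map (fun z => ((z.1.1, z.2.1), z.2.2)) =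
        γ.map (fun z => (z.1.1, z.2.1)) ⊗ₘ (condK (γ.map Prod.snd)).prodMkLeft ℝ := by
  have h1 := forall_condExp_eq_iff_map_eq_compProd (P := γ) (X := fun z => z.1.1)
    (X' := fun z => z.1.2) (Y := fun z => z.2.1) (by fun_prop) (by fun_prop) (by fun_prop)
  have h2 := forall_condExp_eq_iff_map_eq_compProd (P := γ) (X := fun z => z.2.1)
    (X' := fun z => z.2.2) (Y := fun z => z.1.1) (by fun_prop) (by fun_prop) (by fun_prop)
  have hswap := map_compProd_comap (γ.map fun z => (z.1.1, z.2.1))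
    ((condK (γ.map Prod.snd)).prodMkRight ℝ) (f := Prod.swap) (by fun_prop)
  rw [Measure.map_map (by fun_prop) (by fun_prop)] at hswap
  have hγ : γ.map (fun z => ((z.2.1, z.1.1), z.2.2)) =
      (γ.map fun z => ((z.1.1, z.2.1), z.2.2)).map (Prod.map Prod.swap id) := by
    rw [Measure.map_map (by fun_prop) (by fun_prop)]
    rfl
  have hinj : Function.Injective
      (Measure.map (Prod.map Prod.swap id) : Measure ((ℝ × ℝ) × ℝ) → Measure ((ℝ × ℝ) × ℝ)) :=
    (MeasurableEquiv.prodComm.prodCongr (.refl ℝ)).map_measurableEquiv_injective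
  rw [condDistrib_eq_condK] at h1 h2
  rw [hγ] at h2
  refine Iff.trans ?_ (and_congr h1 (h2.trans ((Eq.congr_right hswap.symm).trans hinj.eq_iff)))
  exact ⟨fun h => ⟨fun B hB => (h B hB).1, fun B hB => (h B hB).2⟩,
    fun h B hB => ⟨h.1 B hB, h.2 B hB⟩⟩

end Bicausal

section Metric

variable {dund : ℝ → ℝ → ℝ}

lemma IsCompatibleMetric.nonneg_s4 (hd : IsCompatibleMetric dund) (x y : ℝ) : 0 ≤ dund x y := by
  have h := hd.triangle x y x
  rw [hd.self_eq_zero, hd.symm y x] at h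
  linarith

lemma IsCompatibleMetric.continuous (hd : IsCompatibleMetric dund) :
    Continuous fun z : ℝ × ℝ => dund z.1 z.2 := by
  refine continuous_iff_seqContinuous.mpr fun u z hu => ?_
  have h1 := (hd.compatible z.1 fun n => (u n).1).mp ((continuous_fst.tendsto z).comp hu)
  have h2 := (hd.compatible z.2 fun n => (u n).2).mp ((continuous_snd.tendsto z).comp hu)
  rw [tendsto_iff_dist_tendsto_zero]
  refine squeeze_zero (fun _ => dist_nonneg) (fun n => ?_) (by simpa using h1.add h2)
  have t1 := hd.triangle (u n).1 z.1 (u n).2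
  have t2 := hd.triangle z.1 z.2 (u n).2
  have t3 := hd.triangle z.1 (u n).1 z.2
  have t4 := hd.triangle (u n).1 (u n).2 z.2
  rw [hd.symm z.2 (u n).2] at t2
  rw [hd.symm z.1 (u n).1] at t3
  rw [Function.comp_apply, Real.dist_eq, abs_le]
  constructor <;> linarith

lemma rpow_add_three_le {p x y z : ℝ} (hp : 0 ≤ p) (hx : 0 ≤ x) (hy : 0 ≤ y) (hz : 0 ≤ z) :
    (x + y + z) ^ p ≤ 3 ^ p * x ^ p + 3 ^ p * (y ^ p + z ^ p) := by
  have hm : 0 ≤ max x (max y z) := hx.trans (le_max_left _ _)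
  have hle : x + y + z ≤ 3 * max x (max y z) := by
    have h1 := le_max_left x (max y z)
    have h2 := (le_max_left y z).trans (le_max_right x (max y z))
    have h3 := (le_max_right y z).trans (le_max_right x (max y z))
    linarith
  refine (Real.rpow_le_rpow (by positivity) hle hp).trans ?_
  rw [Real.mul_rpow (by norm_num) hm, ← mul_add]
  gcongr
  have h1 := Real.rpow_nonneg hx p
  have h2 := Real.rpow_nonneg hy p
  have h3 := Real.rpow_nonneg hz p
  rcases max_choice x (max y z) with h | h <;> rw [h]
  · linarith
  · rcases max_choice y z with h | h <;> rw [h] <;> linarith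

end Metric

section Recursion

variable {p : ℝ} {dund : ℝ → ℝ → ℝ} {μ ν : Measure (ℝ × ℝ)}

lemma Wp_rpow (hp : p ≠ 0) (m m' : Measure ℝ) :
    Wp p dund m m' ^ p = ⨅ η : {η : Measure (ℝ × ℝ) // η ∈ coupling m m'},
      ∫⁻ q : ℝ × ℝ, ENNReal.ofReal (dund q.1 q.2 ^ p) ∂(η : Measure (ℝ × ℝ)) := by
  rw [Wp, ← ENNReal.rpow_mul, one_div_mul_cancel hp, ENNReal.rpow_one]

lemma nestedDist2_rpow (hp : p ≠ 0) :
    nestedDist2 p dund μ ν ^ p =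
      ⨅ γ : {γ : Measure ((ℝ × ℝ) × (ℝ × ℝ)) // γ ∈ coupling μ ν ∧ Bicausal2 γ},
        ∫⁻ z, cost2 p dund z ∂(γ : Measure _) := by
  rw [nestedDist2, ← ENNReal.rpow_mul, one_div_mul_cancel hp, ENNReal.rpow_one]

lemma map_fst_compProd_condK (μ : Measure (ℝ × ℝ)) [IsFiniteMeasure μ] :
    μ.map Prod.fst ⊗ₘ condK μ = μ := by
  rw [condK_eq]
  exact μ.disintegrate μ.condKernel

lemma cost2_eq_add (hd : IsCompatibleMetric dund) (z : (ℝ × ℝ) × (ℝ × ℝ)) :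
    cost2 p dund z =
      ENNReal.ofReal (dund z.1.1 z.2.1 ^ p) + ENNReal.ofReal (dund z.1.2 z.2.2 ^ p) :=
  ENNReal.ofReal_add (Real.rpow_nonneg (hd.nonneg_s4 _ _) _) (Real.rpow_nonneg (hd.nonneg_s4 _ _) _)

lemma IsCompatibleMetric.continuous_rpow (hd : IsCompatibleMetric dund) (hp : 0 ≤ p) :
    Continuous fun z : ℝ × ℝ => dund z.1 z.2 ^ p :=
  hd.continuous.rpow_const fun _ => Or.inr hp

lemma ae_lintegral_condK_lt_top (hd : IsCompatibleMetric dund) (hp : 0 ≤ p)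
    [IsProbabilityMeasure μ] {x₀ : ℝ × ℝ} (hx₀ : ∫⁻ x, cost2 p dund (x, x₀) ∂μ < ⊤) :
    ∀ᵐ x ∂(μ.map Prod.fst), ∫⁻ y, ENNReal.ofReal (dund y x₀.2 ^ p) ∂(condK μ x) < ⊤ := by
  have hcont : Continuous fun y => dund y x₀.2 ^ p :=
    (hd.continuous_rpow hp).comp (Continuous.prodMk_left x₀.2)
  have hm : Measurable fun w : ℝ × ℝ => ENNReal.ofReal (dund w.2 x₀.2 ^ p) :=
    hcont.measurable.ennreal_ofReal.comp measurable_snd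
  have hle : ∫⁻ w : ℝ × ℝ, ENNReal.ofReal (dund w.2 x₀.2 ^ p) ∂μ < ⊤ := by
    refine lt_of_le_of_lt (lintegral_mono fun w => ?_) hx₀
    rw [cost2_eq_add hd]
    exact le_add_self
  rw [← map_fst_compProd_condK μ, Measure.lintegral_compProd hm] at hle
  exact ae_lt_top hm.lintegral_kernel_prod_right' hle.ne

/-- The law of `((X₁, X₂), (Y₁, Y₂))` when `(X₁, Y₁)` has law `g` and `(X₂, Y₂)` has conditional
law `η` given `(X₁, Y₁)`. -/
def glue (g : Measure (ℝ × ℝ)) (η : Kernel (ℝ × ℝ) (ℝ × ℝ)) : Measure ((ℝ × ℝ) × (ℝ × ℝ)) :=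
  (g ⊗ₘ η).map fun w => ((w.1.1, w.2.1), (w.1.2, w.2.2))

lemma lintegral_cost2_glue (hd : IsCompatibleMetric dund) (hp : 0 ≤ p) (g : Measure (ℝ × ℝ))
    [SFinite g] (η : Kernel (ℝ × ℝ) (ℝ × ℝ)) [IsMarkovKernel η] :
    ∫⁻ z, cost2 p dund z ∂(glue g η) =
      ∫⁻ q, (ENNReal.ofReal (dund q.1 q.2 ^ p) +
        ∫⁻ w, ENNReal.ofReal (dund w.1 w.2 ^ p) ∂(η q)) ∂g := by
  have hc : Measurable fun z : ℝ × ℝ => ENNReal.ofReal (dund z.1 z.2 ^ p) :=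
    (hd.continuous_rpow hp).measurable.ennreal_ofReal
  have h1 : Measurable fun z : (ℝ × ℝ) × (ℝ × ℝ) => ENNReal.ofReal (dund z.1.1 z.2.1 ^ p) :=
    hc.comp (g := fun z : ℝ × ℝ => ENNReal.ofReal (dund z.1 z.2 ^ p))
      (f := fun z : (ℝ × ℝ) × (ℝ × ℝ) => (z.1.1, z.2.1)) (by fun_prop)
  have h2 : Measurable fun z : (ℝ × ℝ) × (ℝ × ℝ) => ENNReal.ofReal (dund z.1.2 z.2.2 ^ p) :=
    hc.comp (g := fun z : ℝ × ℝ => ENNReal.ofReal (dund z.1 z.2 ^ p))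
      (f := fun z : (ℝ × ℝ) × (ℝ × ℝ) => (z.1.2, z.2.2)) (by fun_prop)
  have h12 : Measurable fun z : (ℝ × ℝ) × (ℝ × ℝ) => ENNReal.ofReal (dund z.1.1 z.2.1 ^ p) +
      ENNReal.ofReal (dund z.1.2 z.2.2 ^ p) := h1.add h2
  simp_rw [cost2_eq_add hd]
  rw [glue, lintegral_map h12 (by fun_prop)]
  refine (Measure.lintegral_compProd ((hc.comp measurable_fst).add
    (hc.comp measurable_snd))).trans (lintegral_congr fun q => ?_)
  simp only [Pi.add_apply, Function.comp_apply]
  rw [lintegral_add_left measurable_const, lintegral_const, measure_univ, mul_one]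

lemma Bicausal2.exists_eq_glue [IsProbabilityMeasure μ] [IsProbabilityMeasure ν]
    {γ : Measure ((ℝ × ℝ) × (ℝ × ℝ))} (hγ : γ ∈ coupling μ ν) (hb : Bicausal2 γ) :
    ∃ g ∈ coupling (μ.map Prod.fst) (ν.map Prod.fst), ∃ η : Kernel (ℝ × ℝ) (ℝ × ℝ),
      IsMarkovKernel η ∧ (∀ᵐ q ∂g, η q ∈ coupling (condK μ q.1) (condK ν q.2)) ∧
        γ = glue g η := by
  have := isProbabilityMeasure_of_mem_coupling_s4 hγ
  obtain ⟨h1, h2⟩ := (bicausal2_iff γ).mp hb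
  rw [hγ.1] at h1
  rw [hγ.2] at h2
  let Q : (ℝ × ℝ) × (ℝ × ℝ) → ℝ × ℝ := fun z => (z.1.1, z.2.1)
  let R : (ℝ × ℝ) × (ℝ × ℝ) → ℝ × ℝ := fun z => (z.1.2, z.2.2)
  have hR : Measurable R := by fun_prop
  refine ⟨γ.map Q, ⟨?_, ?_⟩, condDistrib R Q γ, inferInstance, ?_, ?_⟩
  · rw [← hγ.1, Measure.map_map (by fun_prop) (by fun_prop),
      Measure.map_map (by fun_prop) (by fun_prop)]
    rfl
  · rw [← hγ.2, Measure.map_map (by fun_prop) (by fun_prop),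
      Measure.map_map (by fun_prop) (by fun_prop)]
    rfl
  · filter_upwards [condDistrib_comp Q hR.aemeasurable (measurable_fst (α := ℝ) (β := ℝ)),
      condDistrib_comp Q hR.aemeasurable (measurable_snd (α := ℝ) (β := ℝ)),
      condDistrib_ae_eq_of_measure_eq_compProd Q (Y := Prod.fst ∘ R) (by fun_prop) h1,
      condDistrib_ae_eq_of_measure_eq_compProd Q (Y := Prod.snd ∘ R) (by fun_prop) h2]
      with q e1 e2 e3 e4
    rw [e1, Kernel.map_apply _ (by fun_prop)] at e3
    rw [e2, Kernel.map_apply _ (by fun_prop)] at e4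
    exact ⟨e3, e4⟩
  · rw [glue, compProd_map_condDistrib hR.aemeasurable,
      Measure.map_map (by fun_prop) (by fun_prop)]
    exact Measure.map_id.symm

lemma glue_mem_coupling_and_bicausal2 [IsProbabilityMeasure μ] [IsProbabilityMeasure ν]
    {g : Measure (ℝ × ℝ)} (hg : g ∈ coupling (μ.map Prod.fst) (ν.map Prod.fst))
    {η : Kernel (ℝ × ℝ) (ℝ × ℝ)} [IsMarkovKernel η]
    (hη : ∀ q, η q ∈ coupling (condK μ q.1) (condK ν q.2)) :
    glue g η ∈ coupling μ ν ∧ Bicausal2 (glue g η) := by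
  have hgp : IsProbabilityMeasure g := by
    have := Measure.isProbabilityMeasure_map (μ := μ) measurable_fst.aemeasurable
    exact isProbabilityMeasure_of_mem_coupling_s4 hg
  have e1 : η.map Prod.fst = (condK μ).prodMkRight ℝ := by
    ext1 q
    rw [Kernel.map_apply _ measurable_fst, (hη q).1]
    rfl
  have e2 : η.map Prod.snd = (condK ν).prodMkLeft ℝ := by
    ext1 q
    rw [Kernel.map_apply _ measurable_snd, (hη q).2]
    rfl
  have hQ : (glue g η).map (fun z => (z.1.1, z.2.1)) = g := by
    rw [glue, Measure.map_map (by fun_prop) (by fun_prop)]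
    exact Measure.fst_compProd g η
  have h1 : (glue g η).map (fun z => ((z.1.1, z.2.1), z.1.2)) =
      g ⊗ₘ (condK μ).prodMkRight ℝ := by
    rw [glue, Measure.map_map (by fun_prop) (by fun_prop), ← e1,
      Measure.compProd_map measurable_fst]
    rfl
  have h2 : (glue g η).map (fun z => ((z.1.1, z.2.1), z.2.2)) =
      g ⊗ₘ (condK ν).prodMkLeft ℝ := by
    rw [glue, Measure.map_map (by fun_prop) (by fun_prop), ← e2,
      Measure.compProd_map measurable_snd]
    rfl
  have hc : glue g η ∈ coupling μ ν := by
    constructor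
    · have h := map_compProd_comap g (condK μ) measurable_fst
      rw [hg.1, map_fst_compProd_condK] at h
      refine Eq.trans ?_ h
      change _ = (g ⊗ₘ (condK μ).prodMkRight ℝ).map _
      rw [← h1, Measure.map_map (by fun_prop) (by fun_prop)]
      rfl
    · have h := map_compProd_comap g (condK ν) measurable_snd
      rw [hg.2, map_fst_compProd_condK] at h
      refine Eq.trans ?_ h
      change _ = (g ⊗ₘ (condK ν).prodMkLeft ℝ).map _
      rw [← h2, Measure.map_map (by fun_prop) (by fun_prop)]
      rfl
  have := isProbabilityMeasure_of_mem_coupling_s4 hc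
  refine ⟨hc, (bicausal2_iff _).mpr ⟨?_, ?_⟩⟩
  · rw [hc.1, hQ, h1]
  · rw [hc.2, hQ, h2]

end Recursion

/-- the recursive formula for the nested distance on `𝒫^p(ℝ²)`:
`d_p^nd(μ,ν)^p = inf_{γ̄ ∈ Π(μ₁,ν₁)} ∫ [d̲(x,y)^p + W_p(μ^x,ν^y)^p] γ̄(dx,dy)`. -/
theorem nestedDist_recursive (p : ℝ) (hp : 1 ≤ p)
    (dund : ℝ → ℝ → ℝ) (hd : IsCompatibleMetric dund)
    (μ ν : Measure (ℝ × ℝ)) (hμ : MemP2 p dund μ) (hν : MemP2 p dund ν) :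
    nestedDist2 p dund μ ν ^ p =
      ⨅ g : {g : Measure (ℝ × ℝ) // g ∈ coupling (μ.map Prod.fst) (ν.map Prod.fst)},
        ∫⁻ q : ℝ × ℝ,
          (ENNReal.ofReal (dund q.1 q.2 ^ p) +
            Wp p dund (condK μ q.1) (condK ν q.2) ^ p) ∂(g : Measure (ℝ × ℝ)) := by
  have hp0 : 0 < p := one_pos.trans_le hp
  obtain ⟨hμp, x₀, hx₀⟩ := hμ
  obtain ⟨hνp, y₀, hy₀⟩ := hν
  have hμ₁ := Measure.isProbabilityMeasure_map (μ := μ) measurable_fst.aemeasurable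
  rw [nestedDist2_rpow hp0.ne']
  apply le_antisymm
  · refine le_iInf fun ⟨g, hg⟩ => ENNReal.le_of_forall_pos_le_add fun ε hε _ => ?_
    have hgp : IsProbabilityMeasure g := isProbabilityMeasure_of_mem_coupling_s4 hg
    have hcont (w : ℝ) : Continuous fun x => dund x w ^ p :=
      (hd.continuous_rpow hp0.le).comp (Continuous.prodMk_left w)
    have hnn (x y : ℝ) : 0 ≤ dund x y ^ p := Real.rpow_nonneg (hd.nonneg_s4 _ _) _
    have h3 : (0 : ℝ) ≤ 3 ^ p := by positivity
    obtain ⟨η, hηM, hη, hηε⟩ := exists_kernel_nearly_optimal (condK μ) (condK ν)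
      (c := fun z => dund z.1 z.2 ^ p) (a := fun x => 3 ^ p * dund x x₀.2 ^ p)
      (b := fun y => 3 ^ p * (dund x₀.2 y₀.2 ^ p + dund y y₀.2 ^ p))
      (hd.continuous_rpow hp0.le) ((hcont _).const_mul _)
      (((hcont _).const_add _).const_mul _) (fun _ => hnn _ _)
      (fun _ => mul_nonneg h3 (hnn _ _)) (fun _ => mul_nonneg h3 (add_nonneg (hnn _ _) (hnn _ _)))
      (fun z => by
        refine le_trans (Real.rpow_le_rpow (hd.nonneg_s4 _ _) ?_ hp0.le)
          (rpow_add_three_le hp0.le (hd.nonneg_s4 _ _) (hd.nonneg_s4 _ _) (hd.nonneg_s4 _ _))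
        have t1 := hd.triangle z.1 x₀.2 z.2
        have t2 := hd.triangle x₀.2 y₀.2 z.2
        rw [hd.symm y₀.2 z.2] at t2
        linarith) (ENNReal.coe_pos.mpr hε).ne'
    have hx := ae_lintegral_condK_lt_top hd hp0.le hx₀
    have hy := ae_lintegral_condK_lt_top hd hp0.le hy₀
    rw [← hg.1] at hx
    rw [← hg.2] at hy
    refine (iInf_le _ ⟨glue g η, glue_mem_coupling_and_bicausal2 hg hη⟩).trans ?_
    rw [lintegral_cost2_glue hd hp0.le]
    calc _ ≤ ∫⁻ q : ℝ × ℝ, ((ENNReal.ofReal (dund q.1 q.2 ^ p) +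
            Wp p dund (condK μ q.1) (condK ν q.2) ^ p) + ε) ∂g := by
          refine lintegral_mono_ae ?_
          filter_upwards [ae_of_ae_map (by fun_prop) hx, ae_of_ae_map (by fun_prop) hy]
            with q hqx hqy
          rw [add_assoc, Wp_rpow hp0.ne']
          gcongr
          refine hηε q ?_ ?_
          · simp_rw [ENNReal.ofReal_mul h3]
            rw [lintegral_const_mul _ (hcont _).measurable.ennreal_ofReal]
            exact ENNReal.mul_ne_top ENNReal.ofReal_ne_top hqx.ne
          · simp_rw [ENNReal.ofReal_mul h3, ENNReal.ofReal_add (hnn _ _) (hnn _ _)]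
            rw [lintegral_const_mul _ ((hcont _).measurable.ennreal_ofReal.const_add _),
              lintegral_add_left measurable_const]
            simpa using ENNReal.mul_ne_top ENNReal.ofReal_ne_top
              (ENNReal.add_ne_top.mpr ⟨ENNReal.ofReal_ne_top, hqy.ne⟩)
      _ = _ := by
          rw [lintegral_add_right _ measurable_const]
          simp
  · refine le_iInf fun ⟨γ, hγ, hb⟩ => ?_
    obtain ⟨g, hg, η, hηM, hη, rfl⟩ := hb.exists_eq_glue hγ
    have hgp : IsProbabilityMeasure g := isProbabilityMeasure_of_mem_coupling_s4 hg
    rw [lintegral_cost2_glue hd hp0.le]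
    refine (iInf_le _ ⟨g, hg⟩).trans (lintegral_mono_ae ?_)
    filter_upwards [hη] with q hq
    rw [Wp_rpow hp0.ne']
    gcongr
    exact iInf_le (fun η : {η // η ∈ coupling (condK μ q.1) (condK ν q.2)} =>
      ∫⁻ w : ℝ × ℝ, ENNReal.ofReal (dund w.1 w.2 ^ p) ∂(η : Measure (ℝ × ℝ))) ⟨η q, hq⟩
end
end
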